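/- Let (G,ρ) be a group with a two-sided invariant metric ρ, complete with respect to ρ, and let c : Γ × ∂Γ → G be a Hölder continuous cocycle with exponent τ. Assume c(g,g⁺) = c(g,g⁻) = e for every infinite order element g ∈ Γ. Then there exists a continuous map b : ∂Γ → G satisfying c(g,ξ) = b(ξ)·b(g⁻¹ξ)⁻¹ for all g ∈ Γ and ξ ∈ ∂Γ; moreover b is Hölder continuous with the same exponent, i.e. there is A > 0 with ρ(b(ξ),b(η)) ≤ A·τ^{(ξ|η)} for all ξ, η ∈ ∂Γ. (A Livschitz type theorem for the boundary action.) -/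

import Mathlib

open Filter Topology MeasureTheory
open scoped ENNReal

namespace HarmonicBoundary

variable {Γ : Type} [Group Γ]

/-- Word length of `g` with respect to a generating set `S`. -/
noncomputable def wl (S : Set Γ) (g : Γ) : ℕ :=
  sInf {n : ℕ | ∃ w : List Γ, w.length = n ∧ (∀ x ∈ w, x ∈ S) ∧ w.prod = g}

/-- Word metric `d(x,y) = |x⁻¹y|`. -/
noncomputable def wdist (S : Set Γ) (x y : Γ) : ℕ := wl S (x⁻¹ * y)

/-- Gromov product `(x|y)_z = (d(x,z)+d(y,z)-d(x,y))/2`. -/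
noncomputable def gp (S : Set Γ) (z x y : Γ) : ℝ :=
  ((wdist S x z : ℝ) + (wdist S y z : ℝ) - (wdist S x y : ℝ)) / 2

/-- `S` is a finite symmetric generating set of `Γ`. -/
def IsGenSet (S : Set Γ) : Prop :=
  S.Finite ∧ (∀ s ∈ S, s⁻¹ ∈ S) ∧ Subgroup.closure S = ⊤

/-- `Γ` is `δ`-hyperbolic with respect to the word metric of `S`:
`(x|y) ≥ min ((x|z), (y|z)) - δ` for all `x y z`. -/
def IsHyperbolic (S : Set Γ) (δ : ℝ) : Prop :=
  0 ≤ δ ∧ ∀ x y z : Γ, min (gp S 1 x z) (gp S 1 y z) - δ ≤ gp S 1 x y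

/-- `Γ` is nonelementary: it has no cyclic subgroup of finite index. -/
def Nonelementary (Γ : Type) [Group Γ] : Prop :=
  ∀ g : Γ, (Subgroup.zpowers g).index = 0

/-- A sequence converges to infinity if `(x_i|x_j) → ∞`. -/
def ConvInf (S : Set Γ) (u : ℕ → Γ) : Prop :=
  Tendsto (fun p : ℕ × ℕ => gp S 1 (u p.1) (u p.2)) atTop atTop

/-- Two sequences converging to infinity are equivalent if `(x_i|y_j) → ∞`. -/
def EquivSeq (S : Set Γ) (u v : ℕ → Γ) : Prop :=
  Tendsto (fun p : ℕ × ℕ => gp S 1 (u p.1) (v p.2)) atTop atTop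

/-- An (abstract model of the) Gromov boundary of `Γ`: the points are exactly the
classes of sequences converging to infinity, modulo the equivalence `EquivSeq`,
together with the natural left action of `Γ`. -/
structure Boundary (Γ : Type) [Group Γ] (S : Set Γ) where
  pt : Type
  cls : (ℕ → Γ) → pt
  cls_surj : ∀ ξ : pt, ∃ u : ℕ → Γ, ConvInf S u ∧ cls u = ξ
  cls_eq : ∀ u v : ℕ → Γ, ConvInf S u → ConvInf S v → (cls u = cls v ↔ EquivSeq S u v)
  smul : Γ → pt → pt
  smul_cls : ∀ (g : Γ) (u : ℕ → Γ), ConvInf S u → smul g (cls u) = cls fun n => g * u n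

/-- Extension of the Gromov product to the boundary:
`(ξ|η) = sup liminf (x_i|y_j)` over sequences representing `ξ` and `η`,
as an extended nonnegative real. -/
noncomputable def bgp {S : Set Γ} (B : Boundary Γ S) (ξ η : B.pt) : ℝ≥0∞ :=
  ⨆ (u : {u : ℕ → Γ // ConvInf S u ∧ B.cls u = ξ})
    (v : {v : ℕ → Γ // ConvInf S v ∧ B.cls v = η}),
    Filter.liminf (fun p : ℕ × ℕ => ENNReal.ofReal (gp S 1 (u.1 p.1) (v.1 p.2))) atTop

/-- Real-valued Gromov product on the boundary (finite for `ξ ≠ η`). -/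
noncomputable def bgpR {S : Set Γ} (B : Boundary Γ S) (ξ η : B.pt) : ℝ := (bgp B ξ η).toReal

/-- The canonical topology of the Gromov boundary: a set is open iff around each of
its points it contains a basic neighbourhood `V_r(p) = {q | (q|p) > r}`. -/
def btop {S : Set Γ} (B : Boundary Γ S) : TopologicalSpace B.pt where
  IsOpen O := ∀ p ∈ O, ∃ r : ℝ≥0∞, r ≠ ⊤ ∧ {q | r < bgp B q p} ⊆ O
  isOpen_univ := fun p _ => ⟨0, ENNReal.zero_ne_top, fun q _ => trivial⟩
  isOpen_inter := by
    intro A A' hA hA' p hp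
    obtain ⟨r1, hr1, h1⟩ := hA p hp.1
    obtain ⟨r2, hr2, h2⟩ := hA' p hp.2
    refine ⟨max r1 r2, (max_lt hr1.lt_top hr2.lt_top).ne, fun q hq => ?_⟩
    have hq' : max r1 r2 < bgp B q p := hq
    exact ⟨h1 (show r1 < bgp B q p from (le_max_left r1 r2).trans_lt hq'),
      h2 (show r2 < bgp B q p from (le_max_right r1 r2).trans_lt hq')⟩
  isOpen_sUnion := by
    intro s hs p hp
    obtain ⟨t, ht, hpt⟩ := hp
    obtain ⟨r, hr, hsub⟩ := hs t ht p hpt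
    exact ⟨r, hr, fun q hq => ⟨t, ht, hsub hq⟩⟩

/-- The attracting fixed point `g⁺ = lim_n gⁿ` of an (infinite order) element. -/
def plusPt {S : Set Γ} (B : Boundary Γ S) (g : Γ) : B.pt := B.cls fun n => g ^ n

/-- The repelling fixed point `g⁻ = lim_n g⁻ⁿ` of an (infinite order) element. -/
def minusPt {S : Set Γ} (B : Boundary Γ S) (g : Γ) : B.pt := B.cls fun n => g⁻¹ ^ n

/-- A geodesic ray starting at the identity. -/
def IsGeodesicRay (S : Set Γ) (x : ℕ → Γ) : Prop :=
  x 0 = 1 ∧ ∀ m n : ℕ, wdist S (x m) (x n) = Nat.dist m n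

/-- A geodesic ray from `e` to the boundary point `ξ`, i.e. an element of `[e,ξ]`. -/
def RayTo {S : Set Γ} (B : Boundary Γ S) (x : ℕ → Γ) (ξ : B.pt) : Prop :=
  IsGeodesicRay S x ∧ ConvInf S x ∧ B.cls x = ξ

/-- A geodesic segment from `x` to `y` (parametrized on `0,…,d(x,y)`),
i.e. an element of `[x,y]`. -/
def IsGeodesicSeg (S : Set Γ) (x y : Γ) (α : ℕ → Γ) : Prop :=
  α 0 = x ∧ α (wdist S x y) = y ∧
  ∀ m n : ℕ, m ≤ wdist S x y → n ≤ wdist S x y → wdist S (α m) (α n) = Nat.dist m n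

/-- The boundary "cylinder" `U(ξ,R)`: all `η` such that for every pair of geodesic
rays `x ∈ [e,ξ]`, `y ∈ [e,η]` one has `lim_n (x(n)|y(n)) > R` (the sequence
`(x(n)|y(n))` is nondecreasing, so the limit exceeds `R` iff some term does). -/
def Uset {S : Set Γ} (B : Boundary Γ S) (ξ : B.pt) (R : ℝ) : Set B.pt :=
  {η | ∀ x y : ℕ → Γ, RayTo B x ξ → RayTo B y η → ∃ n : ℕ, R < gp S 1 (x n) (y n)}

/-- `C_r(p) = {g | (g|e)_p > r}`. -/
def Cset (S : Set Γ) (p : Γ) (r : ℝ) : Set Γ := {g | r < gp S p g 1}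

/-- The `R`-neighbourhood `N(α,R)` of a geodesic segment `α ∈ [x,y]`. -/
def segN (S : Set Γ) (x y : Γ) (α : ℕ → Γ) (R : ℝ) : Set Γ :=
  {g | ∃ i ≤ wdist S x y, (wdist S g (α i) : ℝ) ≤ R}

/-- The `R`-neighbourhood `N(A,R)` of a subset `A ⊆ Γ`. -/
def setN (S : Set Γ) (A : Set Γ) (R : ℝ) : Set Γ :=
  {g | ∃ a ∈ A, (wdist S g a : ℝ) ≤ R}

/-- `μ` is a nondegenerate probability measure on `Γ` with support contained in `S`:
nonnegative, of total mass one, supported in `S`, and the semigroup generated by its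
support is the whole of `Γ`. -/
structure IsRWMeasure (S : Set Γ) (μ : Γ → ℝ) : Prop where
  nonneg : ∀ g, 0 ≤ μ g
  support_subset : ∀ g, μ g ≠ 0 → g ∈ S
  total : ∑' g : Γ, μ g = 1
  nondeg : ∀ g : Γ, ∃ l : List Γ, l ≠ [] ∧ (∀ x ∈ l, 0 < μ x) ∧ l.prod = g

open Classical in
/-- `n`-step transition probabilities `p⁽ⁿ⁾(x,y) = μ*ⁿ(x⁻¹y)` of the random walk. -/
noncomputable def ptrans (μ : Γ → ℝ) : ℕ → Γ → Γ → ℝ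
  | 0 => fun x y => if x = y then 1 else 0
  | n + 1 => fun x y => ∑' z : Γ, ptrans μ n x z * μ (z⁻¹ * y)

/-- Green function `G(x,y) = Σ_n p⁽ⁿ⁾(x,y)`. -/
noncomputable def green (μ : Γ → ℝ) (x y : Γ) : ℝ := ∑' n : ℕ, ptrans μ n x y

/-- `F(x,y) = G(x,y)/G(y,y)`, the probability that the walk from `x` ever hits `y`. -/
noncomputable def greenF (μ : Γ → ℝ) (x y : Γ) : ℝ := green μ x y / green μ y y

/-- The Martin kernel `K(x,y) = G(x,y)/G(e,y)`. -/
noncomputable def martinK (μ : Γ → ℝ) (x y : Γ) : ℝ := green μ x y / green μ 1 y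

open Classical in
/-- Transition probabilities of the walk restricted to `Δ` (killed when leaving `Δ`). -/
noncomputable def ptransR (μ : Γ → ℝ) (Δ : Set Γ) : ℕ → Γ → Γ → ℝ
  | 0 => fun x y => if x = y ∧ x ∈ Δ then 1 else 0
  | n + 1 => fun x y => if y ∈ Δ then ∑' z : Γ, ptransR μ Δ n x z * μ (z⁻¹ * y) else 0

/-- Green function `G_Δ` of the restricted walk. -/
noncomputable def greenR (μ : Γ → ℝ) (Δ : Set Γ) (x y : Γ) : ℝ := ∑' n : ℕ, ptransR μ Δ n x y

/-- `F_Δ(x,y) = G_Δ(x,y)/G_Δ(y,y)`. -/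
noncomputable def greenFR (μ : Γ → ℝ) (Δ : Set Γ) (x y : Γ) : ℝ :=
  greenR μ Δ x y / greenR μ Δ y y

/-- Generating function `G_Δ(x,y|z) = Σ_n p_Δ⁽ⁿ⁾(x,y) zⁿ`. -/
noncomputable def greenRZ (μ : Γ → ℝ) (Δ : Set Γ) (x y : Γ) (z : ℝ) : ℝ :=
  ∑' n : ℕ, ptransR μ Δ n x y * z ^ n

/-- Spectral radius `ρ(P) = lim_n p⁽ⁿ⁾(e,e)^{1/n}` of the walk. -/
noncomputable def specRad (μ : Γ → ℝ) : ℝ :=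
  Filter.limsup (fun n : ℕ => (ptrans μ n 1 1) ^ ((n : ℝ)⁻¹)) atTop

/-- `u` is harmonic on `Λ`: `Σ_h p(g,h) u(h) = u(g)` for `g ∈ Λ`, `p(g,h)=μ(g⁻¹h)`. -/
def HarmonicOn (μ : Γ → ℝ) (u : Γ → ℝ) (Λ : Set Γ) : Prop :=
  ∀ g ∈ Λ, (∑' h : Γ, μ (g⁻¹ * h) * u h) = u g

/-- `u` vanishes at infinity on `Λ`: `u(g_n) → 0` along sequences in `Λ` with `|g_n|→∞`. -/
def VanishesAtInftyOn (S : Set Γ) (u : Γ → ℝ) (Λ : Set Γ) : Prop :=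
  ∀ ε : ℝ, 0 < ε → ∃ M : ℕ, ∀ g ∈ Λ, M ≤ wl S g → |u g| ≤ ε

open Classical in
/-- `r(g) = K(g⁻¹,g⁺)` for infinite order `g`, and `r(g) = 1` for finite order `g`;
here `Kb` is the boundary extension of the Martin kernel. -/
noncomputable def rfun {S : Set Γ} (B : Boundary Γ S) (Kb : Γ → B.pt → ℝ) (g : Γ) : ℝ :=
  if IsOfFinOrder g then 1 else Kb g⁻¹ (plusPt B g)

/-- The ratio set `r(Γ,∂Γ,ν)`: all `l ≥ 0` such that for every `ε > 0` and every
Borel `A` of positive measure there is `g ∈ Γ` such that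
`{ω ∈ gA ∩ A : |d(gν)/dν(ω) − l| < ε}` has positive measure; here the
Radon–Nikodym derivative `d(gν)/dν` is the Martin kernel `Kb g`. -/
def ratioSet {S : Set Γ} (B : Boundary Γ S) [MeasurableSpace B.pt]
    (ν : Measure B.pt) (Kb : Γ → B.pt → ℝ) : Set ℝ :=
  {l : ℝ | 0 ≤ l ∧ ∀ ε : ℝ, 0 < ε → ∀ A : Set B.pt, MeasurableSet A → 0 < ν A →
    ∃ g : Γ, 0 < ν {ω | ω ∈ A ∧ B.smul g⁻¹ ω ∈ A ∧ |Kb g ω - l| < ε}}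

/-- A left invariant finitely additive mean on `Γ`; `Γ` is amenable iff one exists. -/
structure InvariantMean (Γ : Type) [Group Γ] where
  m : Set Γ → ℝ
  nonneg : ∀ A, 0 ≤ m A
  total : m Set.univ = 1
  fin_add : ∀ A B : Set Γ, Disjoint A B → m (A ∪ B) = m A + m B
  invariant : ∀ (g : Γ) (A : Set Γ), m ((g * ·) ⁻¹' A) = m A


/-! ### Abstract geometry of a hyperbolic length function -/

/-- Gromov product at the identity of a length function. -/
noncomputable def PP (l : Γ → ℝ) (x y : Γ) : ℝ := (l x + l y - l (x⁻¹ * y)) / 2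

/-- Hyperbolic length function with finite balls and geodesics. -/
structure HL (l : Γ → ℝ) (δ : ℝ) : Prop where
  one : l 1 = 0
  inv : ∀ x, l x⁻¹ = l x
  mul : ∀ x y, l (x * y) ≤ l x + l y
  d0 : 0 ≤ δ
  hyp : ∀ x y z, min (PP l x z) (PP l y z) - δ ≤ PP l x y
  fin : ∀ R : ℝ, {x | l x ≤ R}.Finite
  geo : ∀ v, ∃ (M : ℕ) (x : ℕ → Γ), l v = M ∧ x 0 = 1 ∧ x M = v ∧
    ∀ i j, i ≤ j → j ≤ M → l ((x i)⁻¹ * x j) = (j : ℝ) - i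

namespace HL

variable {l : Γ → ℝ} {δ : ℝ}

lemma nonneg (H : HL l δ) (x : Γ) : 0 ≤ l x := by
  have := H.mul x x⁻¹
  rw [mul_inv_cancel, H.one, H.inv] at this
  linarith

lemma comm (H : HL l δ) (x y : Γ) : PP l x y = PP l y x := by
  unfold PP
  have : l (x⁻¹ * y) = l (y⁻¹ * x) := by rw [← H.inv]; congr 1; group
  rw [this]; ring

lemma pnonneg (H : HL l δ) (x y : Γ) : 0 ≤ PP l x y := by
  unfold PP
  have := H.mul x⁻¹ y
  rw [H.inv] at this
  linarith

lemma ple (H : HL l δ) (x y : Γ) : PP l x y ≤ l x := by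
  unfold PP
  have := H.mul x (x⁻¹ * y)
  rw [mul_inv_cancel_left] at this
  linarith

lemma ple' (H : HL l δ) (x y : Γ) : PP l x y ≤ l y := by
  rw [H.comm]; exact H.ple y x

lemma pone (H : HL l δ) (x : Γ) : PP l x 1 = 0 := by
  unfold PP
  simp [H.one, H.inv]

lemma pself (H : HL l δ) (x : Γ) : PP l x x = l x := by
  unfold PP
  simp [H.one]

lemma pmul (H : HL l δ) (g x y : Γ) :
    PP l (g * x) (g * y) = PP l x y + l g - PP l x g⁻¹ - PP l y g⁻¹ := by
  unfold PP
  have e1 : (g * x)⁻¹ * (g * y) = x⁻¹ * y := by group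
  have e2 : l (x⁻¹ * g⁻¹) = l (g * x) := by rw [← H.inv]; congr 1; group
  have e3 : l (y⁻¹ * g⁻¹) = l (g * y) := by rw [← H.inv]; congr 1; group
  rw [e1, e2, e3, H.inv]; ring

lemma pleft (H : HL l δ) (g x : Γ) : PP l g (g * x) = l g - PP l g⁻¹ x := by
  unfold PP
  simp only [inv_mul_cancel_left, inv_inv, H.inv]; ring

lemma lsub (H : HL l δ) (g x : Γ) : l x - l g ≤ l (g * x) := by
  have := H.mul g⁻¹ (g * x)
  rw [inv_mul_cancel_left, H.inv] at this
  linarith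

lemma lsub' (H : HL l δ) (x g : Γ) : l x - l g ≤ l (x * g) := by
  have := H.mul (x * g) g⁻¹
  rw [mul_inv_cancel_right, H.inv] at this
  linarith

lemma pmul_ge (H : HL l δ) (g x y : Γ) : PP l x y - l g ≤ PP l (g * x) (g * y) := by
  unfold PP
  have e1 : (g * x)⁻¹ * (g * y) = x⁻¹ * y := by group
  rw [e1]
  have := H.lsub g x
  have := H.lsub g y
  linarith

lemma pmul_le (H : HL l δ) (g x y : Γ) : PP l (g * x) (g * y) ≤ PP l x y + l g := by
  have := H.pmul_ge g⁻¹ (g * x) (g * y)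
  rw [inv_mul_cancel_left, inv_mul_cancel_left, H.inv] at this
  linarith

/-- right perturbation -/
lemma plip (H : HL l δ) (x g y : Γ) : PP l (x * g) y ≤ PP l x y + l g := by
  unfold PP
  have h1 := H.mul x g
  have h2 := H.lsub (g⁻¹) (x⁻¹ * y)
  rw [H.inv] at h2
  have e1 : (x * g)⁻¹ * y = g⁻¹ * (x⁻¹ * y) := by group
  rw [e1]
  linarith

lemma plip' (H : HL l δ) (x g y : Γ) : PP l x y - l g ≤ PP l (x * g) y := by
  have := H.plip (x * g) g⁻¹ y
  rw [mul_inv_cancel_right, H.inv] at this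
  linarith

lemma hy (H : HL l δ) {x y z : Γ} {a : ℝ} (h1 : a ≤ PP l x z) (h2 : a ≤ PP l z y) :
    a - δ ≤ PP l x y := by
  have := H.hyp x y z
  rw [H.comm y z] at this
  have := le_min h1 h2
  linarith

lemma hn (H : HL l δ) {x y z : Γ} {C : ℝ} (h1 : PP l x y ≤ C) (h2 : C + δ < PP l x z) :
    PP l z y ≤ C + δ := by
  by_contra h
  push Not at h
  rcases le_total (PP l x z) (PP l z y) with h3 | h3
  · have := H.hy le_rfl h3
    linarith
  · have := H.hy h3 le_rfl
    linarith

lemma inv_pow_inv (g : Γ) (n : ℕ) : (g ^ n)⁻¹ = g⁻¹ ^ n := (inv_pow g n).symm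

lemma lpow (H : HL l δ) (g : Γ) (n : ℕ) : l (g ^ n) ≤ n * l g := by
  induction n with
  | zero => simp [H.one]
  | succ n ih =>
    rw [pow_succ]
    have := H.mul (g ^ n) g
    push_cast
    linarith

/-! powers of a non-backtracking element -/

lemma pw_a (H : HL l δ) {v : Γ} {C : ℝ} (hC : 0 ≤ C) (hv : PP l v v⁻¹ ≤ C)
    (hL : 2 * C + 3 * δ + 1 ≤ l v) (n : ℕ) : PP l v⁻¹ (v ^ n) ≤ C + δ := by
  have hd := H.d0
  induction n with
  | zero => rw [pow_zero, H.pone]; linarith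
  | succ n ih =>
    have h1 := H.pleft v (v ^ n)
    rw [← pow_succ'] at h1
    rw [H.comm]
    exact H.hn hv (by linarith)

lemma pw_b (H : HL l δ) {v : Γ} {C : ℝ} (hC : 0 ≤ C) (hv : PP l v v⁻¹ ≤ C)
    (hL : 2 * C + 3 * δ + 1 ≤ l v) (n : ℕ) : PP l v (v⁻¹ ^ n) ≤ C + δ := by
  have := H.pw_a (v := v⁻¹) hC (by rwa [inv_inv, H.comm]) (by rwa [H.inv]) n
  rwa [inv_inv] at this

lemma pw_c (H : HL l δ) {v : Γ} {C : ℝ} (hC : 0 ≤ C) (hv : PP l v v⁻¹ ≤ C)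
    (hL : 2 * C + 3 * δ + 1 ≤ l v) (n m : ℕ) : PP l (v⁻¹ ^ n) (v ^ m) ≤ C + 2 * δ := by
  have hd := H.d0
  cases n with
  | zero => rw [pow_zero, H.comm, H.pone]; linarith
  | succ n =>
    have h1 := H.pleft v⁻¹ (v⁻¹ ^ n)
    rw [← pow_succ', inv_inv, H.inv] at h1
    have h2 := H.pw_b hC hv hL n
    have h3 := H.pw_a hC hv hL m
    have := H.hn (z := v⁻¹ ^ (n + 1)) h3 (by linarith)
    linarith

lemma pw_d (H : HL l δ) {v : Γ} {C : ℝ} (hC : 0 ≤ C) (hv : PP l v v⁻¹ ≤ C)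
    (hL : 2 * C + 3 * δ + 1 ≤ l v) (n : ℕ) : (n : ℝ) ≤ l (v ^ n) := by
  have hd := H.d0
  induction n with
  | zero => simp [H.one]
  | succ n ih =>
    have h1 := H.pw_a hC hv hL n
    unfold PP at h1
    rw [inv_inv, ← pow_succ', H.inv] at h1
    push_cast
    linarith

lemma pw_e (H : HL l δ) {v : Γ} {C : ℝ} (hC : 0 ≤ C) (hv : PP l v v⁻¹ ≤ C)
    (hL : 2 * C + 3 * δ + 1 ≤ l v) {n m : ℕ} (hnm : n ≤ m) :
    (n : ℝ) - C - 2 * δ ≤ PP l (v ^ n) (v ^ m) := by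
  obtain ⟨k, rfl⟩ := Nat.exists_eq_add_of_le hnm
  rw [pow_add, H.pleft, inv_pow_inv]
  have := H.pw_c hC hv hL n k
  have := H.pw_d hC hv hL n
  linarith

/-- Data of a hyperbolic element. -/
structure HP (l : Γ → ℝ) (δ : ℝ) (h : Γ) (K : ℝ) : Prop where
  c : ∀ n m : ℕ, PP l (h⁻¹ ^ n) (h ^ m) ≤ K
  d : ∀ n : ℕ, (n : ℝ) ≤ l (h ^ n)
  e : 2 * K + 2 * δ < l h

lemma HP.symm (H : HL l δ) {h : Γ} {K : ℝ} (hp : HP l δ h K) : HP l δ h⁻¹ K where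
  c n m := by rw [inv_inv, H.comm]; exact hp.c m n
  d n := by rw [← inv_pow_inv, H.inv]; exact hp.d n
  e := by rw [H.inv]; exact hp.e

lemma exists_HP (H : HL l δ) [Infinite Γ] : ∃ h K, 0 ≤ K ∧ HP l δ h K := by
  have hd := H.d0
  obtain ⟨r, hr⟩ := exists_nat_gt δ
  obtain ⟨T, hT⟩ := exists_nat_gt ((r : ℝ) + 8 * δ + 1)
  have hrT : r ≤ T := by
    have : (r : ℝ) ≤ T := by linarith
    exact_mod_cast this
  have hfin := H.fin r
  set n := hfin.toFinset.card with hn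
  obtain ⟨v, hv⟩ : ∃ v, (T * (n + 1) : ℕ) < l v := by
    by_contra hcon
    push Not at hcon
    exact Set.infinite_univ ((H.fin (T * (n + 1) : ℕ)).subset (fun x _ => hcon x))
  obtain ⟨M, x, hM, -, -, hx⟩ := H.geo v
  rw [hM] at hv
  have hM' : T * (n + 1) < M := by exact_mod_cast hv
  have key : ∀ a ∈ Finset.range (n + 1), (fun a => (x (T * a))⁻¹ * x (T * a + r)) a ∈ hfin.toFinset := by
    intro a ha
    simp only [Set.Finite.mem_toFinset, Set.mem_ofPred_eq]
    have ha' : a ≤ n := by simpa [Nat.lt_succ_iff] using ha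
    rw [hx _ _ (by omega) (by nlinarith)]
    push_cast; linarith
  obtain ⟨a, ha, b, hb, hab, hEq⟩ := Finset.exists_ne_map_eq_of_card_lt_of_maps_to
    (by simp [← hn]) key
  clear key
  have main : ∀ a b : ℕ, a < b → b ≤ n → (x (T * a))⁻¹ * x (T * a + r) = (x (T * b))⁻¹ * x (T * b + r)
      → ∃ h K, 0 ≤ K ∧ HP l δ h K := by
    intro a b hab hb hEq
    have hj : T * a + T ≤ T * b := by nlinarith
    have hjM : T * b + r ≤ M := by nlinarith
    generalize T * a = i at *
    generalize T * b = j at *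
    have hjR : (i : ℝ) + T ≤ j := by exact_mod_cast hj
    have hu : l ((x i)⁻¹ * x j) = (j : ℝ) - i := hx _ _ (by omega) (by omega)
    set u := (x i)⁻¹ * x j with hudef
    set p := (x i)⁻¹ * x (i + r) with hpdef
    have hp : l p = r := by
      have := hx i (i + r) (by omega) (by omega)
      push_cast at this
      rw [hpdef, this]; ring
    have h1 : PP l u p = r := by
      unfold PP
      have e : u⁻¹ * p = ((x (i + r))⁻¹ * x j)⁻¹ := by rw [hudef, hpdef]; group
      have := hx (i + r) j (by omega) (by omega)
      rw [e, H.inv, this, hu, hp]; push_cast; ring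
    have h2 : PP l u⁻¹ p = 0 := by
      unfold PP
      have e : u⁻¹⁻¹ * p = ((x i)⁻¹ * x (j + r)) := by rw [hEq, hudef]; group
      have := hx i (j + r) (by omega) (by omega)
      rw [e, H.inv, this, hu, hp]; push_cast; ring
    have h3 : PP l u u⁻¹ ≤ δ := by
      have := H.hn (x := p) (y := u⁻¹) (z := u) (C := 0) (by rw [H.comm, h2]) (by
        rw [H.comm, h1]; linarith)
      linarith
    have hL : 2 * δ + 3 * δ + 1 ≤ l u := by rw [hu]; linarith
    refine ⟨u, 3 * δ, by linarith, ⟨fun n m => ?_, fun n => H.pw_d hd h3 hL n, by rw [hu]; linarith⟩⟩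
    have := H.pw_c hd h3 hL n m
    linarith
  simp only [Finset.mem_range] at ha hb
  rcases lt_or_gt_of_ne hab with h | h
  · exact main a b h (by omega) hEq
  · exact main b a h (by omega) hEq.symm

/-- Fellow travelling gives commensuration. -/
lemma fellow (H : HL l δ) {g k : Γ} {K : ℝ} (hg : HP l δ g K) (hk : HP l δ k K) (s : Γ)
    (hK : 0 ≤ K)
    (hs : ∀ M : ℝ, ∃ n m : ℕ, M < PP l (s * g ^ n) (k ^ m)) :
    ∃ p : ℕ, 1 ≤ p ∧ ∃ q : ℤ, s * g ^ p * s⁻¹ = k ^ q := by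
  have hd := H.d0
  have hls := H.nonneg s
  have hlg := H.nonneg g
  have hlk := H.nonneg k
  have claim : ∀ n : ℕ, ∃ m : ℕ, l ((k ^ m)⁻¹ * (s * g ^ n)) ≤ l k + 2 * (K + l s + δ) + 2 * δ := by
    intro n
    obtain ⟨n0, m0, hM⟩ := hs (l s + n * l g)
    have ht : l (s * g ^ n) ≤ l s + n * l g := by
      have := H.mul s (g ^ n); have := H.lpow g n; linarith
    have hn0 : n ≤ n0 := by
      by_contra hcon
      push Not at hcon
      have h1 := H.ple (s * g ^ n0) (k ^ m0)
      have h2 := H.mul s (g ^ n0)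
      have h3 := H.lpow g n0
      have h4 : (n0 : ℝ) ≤ n := by exact_mod_cast hcon.le
      have h5 := mul_le_mul_of_nonneg_right h4 hlg
      linarith
    set t := l (s * g ^ n) with htdef
    have ht0 : 0 ≤ t := H.nonneg _
    have h1 : t - (K + l s) ≤ PP l (s * g ^ n) (s * g ^ n0) := by
      obtain ⟨j, rfl⟩ := Nat.exists_eq_add_of_le hn0
      rw [pow_add, ← mul_assoc, H.pleft]
      have e : (s * g ^ n)⁻¹ = g⁻¹ ^ n * s⁻¹ := by rw [mul_inv_rev, inv_pow_inv]
      rw [e]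
      have := H.plip (g⁻¹ ^ n) s⁻¹ (g ^ j)
      rw [H.inv] at this
      have := hg.c n j
      linarith
    have h2 : t - (K + l s) - δ ≤ PP l (s * g ^ n) (k ^ m0) :=
      H.hy h1 (by linarith)
    have hkm : t ≤ l (k ^ m0) := by
      have := H.ple' (s * g ^ n0) (k ^ m0); linarith
    classical
    have hex : ∃ m, t ≤ l (k ^ m) := ⟨m0, hkm⟩
    set m := Nat.find hex with hm
    have hm1 : t ≤ l (k ^ m) := Nat.find_spec hex
    have hm0 : m ≤ m0 := Nat.find_min' hex hkm
    have hm2 : l (k ^ m) ≤ t + l k := by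
      rcases Nat.eq_zero_or_pos m with h0 | h0
      · rw [h0, pow_zero, H.one]; linarith
      · have h3 := Nat.find_min hex (m := m - 1) (by omega)
        push Not at h3
        have h4 := H.mul (k ^ (m - 1)) k
        rw [← pow_succ, Nat.sub_add_cancel h0] at h4
        linarith
    have h5 : t - (K + l s) - δ ≤ PP l (k ^ m0) (k ^ m) := by
      rw [H.comm]
      obtain ⟨j, hj⟩ := Nat.exists_eq_add_of_le hm0
      rw [hj, pow_add, H.pleft, inv_pow_inv]
      have := hk.c m j
      linarith
    have h6 := H.hy h2 h5
    refine ⟨m, ?_⟩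
    rw [H.comm] at h6
    unfold PP at h6
    linarith
  choose m hm using claim
  have hfin := H.fin (l k + 2 * (K + l s + δ) + 2 * δ)
  have : ∃ n1 n2, n1 < n2 ∧ (k ^ m n1)⁻¹ * (s * g ^ n1) = (k ^ m n2)⁻¹ * (s * g ^ n2) := by
    have hmt : Set.MapsTo (fun n => (k ^ m n)⁻¹ * (s * g ^ n)) Set.univ
      {x | l x ≤ l k + 2 * (K + l s + δ) + 2 * δ} := fun n _ => hm n
    obtain ⟨a, -, b, -, hab, he⟩ := Set.infinite_univ.exists_ne_map_eq_of_mapsTo hmt hfin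
    rcases lt_or_gt_of_ne hab with h | h
    · exact ⟨a, b, h, he⟩
    · exact ⟨b, a, h, he.symm⟩
  obtain ⟨n1, n2, hlt, he⟩ := this
  obtain ⟨p, rfl⟩ := Nat.exists_eq_add_of_lt hlt
  refine ⟨p + 1, by omega, (m (n1 + p + 1) : ℤ) - m n1, ?_⟩
  rw [zpow_sub, zpow_natCast, zpow_natCast]
  have e1 : s * g ^ (n1 + p + 1) = k ^ m (n1 + p + 1) * ((k ^ m n1)⁻¹ * (s * g ^ n1)) := by
    rw [he]; group
  have e2 : g ^ (n1 + p + 1) = g ^ (p + 1) * g ^ n1 := by rw [← pow_add]; congr 1; omega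
  rw [e2] at e1
  calc s * g ^ (p + 1) * s⁻¹ = (s * (g ^ (p + 1) * g ^ n1)) * (s * g ^ n1)⁻¹ := by group
    _ = _ := by rw [e1]; group

lemma comm_bound (H : HL l δ) {g k : Γ} {K C0 : ℝ} (hk : HP l δ k K) {s : Γ}
    (hC : ∀ m : ℕ, PP l s (k ^ m) ≤ C0) {p q : ℕ} (hq : 1 ≤ q)
    (hs : s * g ^ p * s⁻¹ = k ^ q) :
    ∃ J : ℕ, ∀ j ≥ J, l s - C0 - δ ≤ PP l s⁻¹ (g ^ (p * j)) := by
  obtain ⟨J, hJ⟩ := exists_nat_gt (C0 + δ + l s)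
  refine ⟨J, fun j hj => ?_⟩
  have e : s * g ^ (p * j) = k ^ (q * j) * s := by
    rw [pow_mul k, ← hs, conj_pow, ← pow_mul]; group
  have h1 : (J : ℝ) ≤ l (k ^ (q * j)) := by
    have : J ≤ q * j := by nlinarith
    have h2 : (J : ℝ) ≤ (q * j : ℕ) := by exact_mod_cast this
    exact h2.trans (hk.d _)
  have h2 : C0 + δ < PP l (k ^ (q * j)) (s * g ^ (p * j)) := by
    rw [e, H.comm]
    have := H.plip' (k ^ (q * j)) s (k ^ (q * j))
    rw [H.pself] at this
    linarith
  have h3 := H.hn (x := k ^ (q * j)) (y := s) (by rw [H.comm]; exact hC (q * j)) h2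
  rw [H.comm, H.pleft] at h3
  linarith

lemma finite_index (H : HL l δ) {h : Γ} {K R : ℝ} (hK : 0 ≤ K) (hp : HP l δ h K)
    (hR : ∀ s, (∀ m : ℕ, PP l s (h ^ m) ≤ l h / 2 + δ) → (∀ m : ℕ, PP l s (h⁻¹ ^ m) ≤ l h / 2 + δ) →
      l s ≤ R) : (Subgroup.zpowers h).index ≠ 0 := by
  have hd := H.d0
  have hbd : ∀ k, HP l δ k K → ∀ s, l s ≤ l (k⁻¹ * s) → ∀ m : ℕ, PP l s (k ^ m) ≤ l k / 2 + δ := by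
    intro k hk s hs m
    have hlk := H.nonneg k
    cases m with
    | zero => rw [pow_zero, H.pone]; linarith
    | succ m =>
      have h1 : PP l k s ≤ l k / 2 := by unfold PP; linarith
      have h2 : l k / 2 + δ < PP l k (k ^ (m + 1)) := by
        rw [pow_succ', H.pleft]
        have he := hk.e
        have := hk.c 1 m
        rw [pow_one] at this
        linarith
      rw [H.comm]
      exact H.hn h1 h2
  have hrep : ∀ x : Γ, ∃ n : ℤ, l (h ^ n * x) ≤ R := by
    intro x
    have hN : ∀ n : ℤ, ∃ M : ℕ, l (h ^ n * x) = M := fun n => by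
      obtain ⟨M, _, hM, _⟩ := H.geo (h ^ n * x); exact ⟨M, hM⟩
    choose f hf using hN
    set n := Function.argmin f with hn
    have hmin : ∀ m : ℤ, l (h ^ n * x) ≤ l (h ^ m * x) := by
      intro m
      rw [hf, hf]
      exact_mod_cast Function.argmin_le f m
    refine ⟨n, hR _ (hbd h hp _ ?_) ?_⟩
    · have := hmin (n - 1)
      rwa [show h ^ (n - 1) * x = h⁻¹ * (h ^ n * x) by group] at this
    · have := hbd h⁻¹ (HP.symm H hp) (h ^ n * x) (by
        have := hmin (n + 1)
        rwa [show h ^ (n + 1) * x = h⁻¹⁻¹ * (h ^ n * x) by group] at this)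
      rwa [H.inv] at this
  have hfin := H.fin R
  have : Finite {x | l x ≤ R} := hfin
  have hsurj : Function.Surjective (fun x : {x | l x ≤ R} => (QuotientGroup.mk (x : Γ) : Γ ⧸ Subgroup.zpowers h)) := by
    intro y
    obtain ⟨y, rfl⟩ := QuotientGroup.mk_surjective y
    obtain ⟨n, hn⟩ := hrep y⁻¹
    refine ⟨⟨(h ^ n * y⁻¹)⁻¹, by rw [Set.mem_ofPred_eq, H.inv]; exact hn⟩, ?_⟩
    simp only
    rw [QuotientGroup.eq]
    rw [inv_inv]
    exact ⟨n, by simp⟩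
  have := Finite.of_surjective _ hsurj
  exact Subgroup.index_ne_zero_of_finite

lemma exists_indep (H : HL l δ) {h : Γ} {K : ℝ} (hK : 0 ≤ K) (hp : HP l δ h K)
    (hidx : (Subgroup.zpowers h).index = 0) :
    ∃ s C1, ∀ g, (g = h ∨ g = h⁻¹) → ∀ k, (k = h ∨ k = h⁻¹) → ∀ n m : ℕ,
      PP l (s * g ^ n) (k ^ m) ≤ C1 := by
  have hd := H.d0
  have hps : ∀ k, (k = h ∨ k = h⁻¹) → HP l δ k K := by
    rintro k (rfl | rfl)
    · exact hp
    · exact HP.symm H hp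
  by_contra hcon
  push Not at hcon
  refine H.finite_index (R := l h / 2 + δ + K + 2 * δ) hK hp (fun s hs1 hs2 => ?_) hidx
  -- unbounded for some fixed pair of signs
  have h1 : ∃ g, (g = h ∨ g = h⁻¹) ∧ ∃ k, (k = h ∨ k = h⁻¹) ∧
      ∀ M : ℝ, ∃ n m : ℕ, M < PP l (s * g ^ n) (k ^ m) := by
    by_contra hc
    push Not at hc
    choose f hf using hc
    have a1 := hf h (.inl rfl) h (.inl rfl)
    have a2 := hf h (.inl rfl) h⁻¹ (.inr rfl)
    have a3 := hf h⁻¹ (.inr rfl) h (.inl rfl)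
    have a4 := hf h⁻¹ (.inr rfl) h⁻¹ (.inr rfl)
    set M1 := f h (.inl rfl) h (.inl rfl)
    set M2 := f h (.inl rfl) h⁻¹ (.inr rfl)
    set M3 := f h⁻¹ (.inr rfl) h (.inl rfl)
    set M4 := f h⁻¹ (.inr rfl) h⁻¹ (.inr rfl)
    obtain ⟨g, hg, k, hk, n, m, hlt⟩ := hcon s (max (max M1 M2) (max M3 M4))
    rw [max_lt_iff, max_lt_iff, max_lt_iff] at hlt
    obtain ⟨⟨b1, b2⟩, b3, b4⟩ := hlt
    rcases hg with rfl | rfl <;> rcases hk with rfl | rfl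
    · exact absurd (a1 n m) (not_le.2 b1)
    · exact absurd (a2 n m) (not_le.2 b2)
    · exact absurd (a3 n m) (not_le.2 b3)
    · exact absurd (a4 n m) (not_le.2 b4)
  obtain ⟨g, hg, k, hk, hM⟩ := h1
  obtain ⟨p, hp1, q, hq⟩ := H.fellow (hps g hg) (hps k hk) s hK hM
  have hsk : ∀ k, (k = h ∨ k = h⁻¹) → ∀ m : ℕ, PP l s (k ^ m) ≤ l h / 2 + δ := by
    rintro k (rfl | rfl)
    · exact hs1
    · exact hs2
  have hinv : ∀ k, (k = h ∨ k = h⁻¹) → (k⁻¹ = h ∨ k⁻¹ = h⁻¹) := by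
    rintro k (rfl | rfl)
    · right; rfl
    · left; rw [inv_inv]
  -- make q a positive natural number
  obtain ⟨k', hk', q', hq1, hq'⟩ : ∃ k', (k' = h ∨ k' = h⁻¹) ∧ ∃ q' : ℕ, 1 ≤ q' ∧
      s * g ^ p * s⁻¹ = k' ^ q' := by
    obtain ⟨a, rfl | rfl⟩ := q.eq_nat_or_neg
    · refine ⟨k, hk, a, ?_, by rw [hq, zpow_natCast]⟩
      by_contra h0
      have h0 : a = 0 := by omega
      rw [h0, Nat.cast_zero, zpow_zero, conj_eq_one_iff] at hq
      have := (hps g hg).d p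
      rw [hq, H.one] at this
      have : (1 : ℝ) ≤ p := by exact_mod_cast hp1
      linarith
    · refine ⟨k⁻¹, hinv k hk, a, ?_, by rw [hq, zpow_neg, zpow_natCast, inv_pow]⟩
      by_contra h0
      have h0 : a = 0 := by omega
      rw [h0, Nat.cast_zero, neg_zero, zpow_zero, conj_eq_one_iff] at hq
      have := (hps g hg).d p
      rw [hq, H.one] at this
      have : (1 : ℝ) ≤ p := by exact_mod_cast hp1
      linarith
  have hq'' : s * g⁻¹ ^ p * s⁻¹ = k'⁻¹ ^ q' := by
    rw [inv_pow k', ← hq', inv_pow]; group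
  obtain ⟨J1, hJ1⟩ := H.comm_bound (hps k' hk') (hsk k' hk') hq1 hq'
  obtain ⟨J2, hJ2⟩ := H.comm_bound (hps _ (hinv k' hk')) (hsk _ (hinv k' hk')) hq1 hq''
  have b1 := hJ1 (max J1 J2) (le_max_left _ _)
  have b2 := hJ2 (max J1 J2) (le_max_right _ _)
  rw [H.comm] at b2
  have b3 := H.hy b2 b1
  have b4 := (hps g hg).c (p * max J1 J2) (p * max J1 J2)
  linarith

/-- Three independent directions. -/
lemma exists_three (H : HL l δ) (hne : Nonelementary Γ) :
    ∃ C0 : ℝ, 0 ≤ C0 ∧ ∃ D : ℝ → ℝ, ∀ n : ℝ, ∃ a : Fin 3 → Γ, (∀ i, n ≤ l (a i) ∧ l (a i) ≤ D n) ∧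
      ∀ i j, i ≠ j → PP l (a i) (a j) ≤ C0 ∧ PP l (a i)⁻¹ (a j)⁻¹ ≤ C0 := by
  have hinf : Infinite Γ := by
    have := hne 1
    rw [Subgroup.zpowers_one_eq_bot, Subgroup.index_bot] at this
    rcases finite_or_infinite Γ with h | h
    · exact absurd this Nat.card_pos.ne'
    · exact h
  obtain ⟨h, K, hK, hp⟩ := H.exists_HP
  obtain ⟨s, C1, hs⟩ := H.exists_indep hK hp (hne h)
  have hls := H.nonneg s
  suffices hsuff : ∃ C0 : ℝ, 0 ≤ C0 ∧ ∀ n : ℝ, ∃ a : Fin 3 → Γ, (∀ i, n ≤ l (a i)) ∧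
      ∀ i j, i ≠ j → PP l (a i) (a j) ≤ C0 ∧ PP l (a i)⁻¹ (a j)⁻¹ ≤ C0 by
    obtain ⟨C0, hC0, hh⟩ := hsuff
    choose a ha1 ha2 using hh
    refine ⟨C0, hC0, fun n => l (a n 0) + l (a n 1) + l (a n 2), fun n => ⟨a n, fun i => ⟨ha1 n i, ?_⟩, ha2 n⟩⟩
    have := H.nonneg (a n 0)
    have := H.nonneg (a n 1)
    have := H.nonneg (a n 2)
    fin_cases i <;> simp <;> linarith
  refine ⟨max K (C1 + l s), le_max_of_le_left hK, fun n => ?_⟩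
  obtain ⟨N, hN⟩ := exists_nat_gt (n + 2 * l s)
  have hpow := hp.d N
  have hsn : ∀ g, (g = h ∨ g = h⁻¹) → ∀ k, (k = h ∨ k = h⁻¹) →
      PP l (s * g ^ N * s⁻¹) (k ^ N) ≤ max K (C1 + l s) := by
    intro g hg k hk
    have := H.plip (s * g ^ N) s⁻¹ (k ^ N)
    rw [H.inv] at this
    have := hs g hg k hk N N
    exact le_max_of_le_right (by linarith)
  have e3 : (s * h ^ N * s⁻¹)⁻¹ = s * h⁻¹ ^ N * s⁻¹ := by rw [inv_pow]; group
  have q1 := hsn h (.inl rfl) h (.inl rfl)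
  have q2 := hsn h (.inl rfl) h⁻¹ (.inr rfl)
  have q3 := hsn h⁻¹ (.inr rfl) h (.inl rfl)
  have q4 := hsn h⁻¹ (.inr rfl) h⁻¹ (.inr rfl)
  have q5 : PP l (h⁻¹ ^ N) (h ^ N) ≤ max K (C1 + l s) := le_max_of_le_left (hp.c N N)
  have q1' := q1
  have q2' := q2
  have q3' := q3
  have q4' := q4
  have q5' := q5
  rw [H.comm] at q1' q2' q3' q4' q5'
  have i1 : (h ^ N)⁻¹ = h⁻¹ ^ N := inv_pow_inv h N
  have i2 : (h⁻¹ ^ N)⁻¹ = h ^ N := by rw [inv_pow_inv, inv_inv]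
  refine ⟨![h ^ N, h⁻¹ ^ N, s * h ^ N * s⁻¹], ?_, ?_⟩
  · have l2 : l (h⁻¹ ^ N) = l (h ^ N) := by rw [← i1, H.inv]
    have l3 : n ≤ l (s * h ^ N * s⁻¹) := by
      have := H.lsub' (s * h ^ N) s⁻¹
      have := H.lsub s (h ^ N)
      rw [H.inv] at *
      linarith
    intro i
    fin_cases i
    · show n ≤ l (h ^ N); linarith
    · show n ≤ l (h⁻¹ ^ N); linarith
    · exact l3
  · intro i j hij
    fin_cases i <;> fin_cases j <;> first | exact absurd rfl hij | skip
    · exact ⟨q5', by show PP l (h ^ N)⁻¹ (h⁻¹ ^ N)⁻¹ ≤ _; rwa [i1, i2]⟩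
    · exact ⟨q1', by show PP l (h ^ N)⁻¹ (s * h ^ N * s⁻¹)⁻¹ ≤ _; rwa [i1, e3]⟩
    · exact ⟨q5, by show PP l (h⁻¹ ^ N)⁻¹ (h ^ N)⁻¹ ≤ _; rwa [i1, i2]⟩
    · exact ⟨q2', by show PP l (h⁻¹ ^ N)⁻¹ (s * h ^ N * s⁻¹)⁻¹ ≤ _; rwa [i2, e3]⟩
    · exact ⟨q1, by show PP l (s * h ^ N * s⁻¹)⁻¹ (h ^ N)⁻¹ ≤ _; rwa [i1, e3]⟩
    · exact ⟨q2, by show PP l (s * h ^ N * s⁻¹)⁻¹ (h⁻¹ ^ N)⁻¹ ≤ _; rwa [i2, e3]⟩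


/-! connecting lemmas -/

/-- Among three independent directions, at most one is close to a given point. -/
lemma three_away (H : HL l δ) {C0 : ℝ} {a : Fin 3 → Γ}
    (ha : ∀ i j, i ≠ j → PP l (a i) (a j) ≤ C0) (p q : Γ) :
    ∃ i, PP l (a i) p ≤ C0 + δ ∧ PP l (a i) q ≤ C0 + δ := by
  have one : ∀ p i j, i ≠ j → C0 + δ < PP l (a i) p → PP l (a j) p ≤ C0 + δ := by
    intro p i j hij h
    rw [H.comm]
    exact H.hn (ha i j hij) h
  by_contra hcon
  push Not at hcon
  have c0 := hcon 0
  have c1 := hcon 1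
  have c2 := hcon 2
  have p01 := one p 0 1 (by decide)
  have p12 := one p 1 2 (by decide)
  have p02 := one p 0 2 (by decide)
  have q01 := one q 0 1 (by decide)
  have q12 := one q 1 2 (by decide)
  have q02 := one q 0 2 (by decide)
  rcases le_or_gt (PP l (a 0) p) (C0 + δ) with h0 | h0
  · have z0 := c0 h0
    have z1 : C0 + δ < PP l (a 1) p := by
      by_contra h; push Not at h; linarith [c1 h, q01 z0]
    have z2 : C0 + δ < PP l (a 2) p := by
      by_contra h; push Not at h; linarith [c2 h, q02 z0]
    linarith [p12 z1]
  · have z1 := c1 (p01 h0)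
    have z2 := c2 (p02 h0)
    linarith [q12 z1]

lemma connect (H : HL l δ) (hne : Nonelementary Γ) :
    ∃ C D : ℝ, 0 ≤ C ∧ 0 ≤ D ∧ ∀ x y : Γ, ∃ a, l a ≤ D ∧ PP l x (a * y) ≤ C := by
  have hd := H.d0
  obtain ⟨C0, hC0, Df, h3⟩ := H.exists_three hne
  obtain ⟨a, ha1, ha2⟩ := h3 (2 * C0 + 5 * δ + 1)
  have hD : 0 ≤ Df (2 * C0 + 5 * δ + 1) := (H.nonneg (a 0)).trans (ha1 0).2
  refine ⟨C0 + 3 * δ, Df (2 * C0 + 5 * δ + 1), by linarith, hD, fun x y => ?_⟩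
  by_contra hcon
  push Not at hcon
  have hc : ∀ i, C0 + 3 * δ < PP l x (a i * y) := fun i => hcon _ (ha1 i).2
  -- some two directions do not cancel
  have hbad : ∀ i j, i ≠ j → C0 + δ < PP l (a i)⁻¹ y ∨ C0 + δ < PP l (a j)⁻¹ y := by
    intro i j hij
    by_contra hno
    push Not at hno
    obtain ⟨h1, h2⟩ := hno
    have e1 : C0 + δ < PP l (a i) (a i * y) := by
      rw [H.pleft]; linarith [(ha1 i).1]
    have e2 : C0 + 2 * δ < PP l (a j) (a j * y) := by
      rw [H.pleft]; linarith [(ha1 j).1]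
    have f1 := H.hn (ha2 i j hij).1 e1
    rw [H.comm] at f1
    have f2 := H.hn f1 (z := a j * y) (by linarith)
    obtain ⟨m, hm, m1, m2⟩ : ∃ m : ℝ, C0 + 3 * δ < m ∧ m ≤ PP l x (a i * y) ∧
        m ≤ PP l x (a j * y) :=
      ⟨min (PP l x (a i * y)) (PP l x (a j * y)), lt_min (hc i) (hc j),
        min_le_left _ _, min_le_right _ _⟩
    have f3 := H.hy (x := a j * y) (y := a i * y) (z := x) (by rw [H.comm]; exact m2) m1
    linarith
  have hgood : ∀ i j, i ≠ j → C0 + δ < PP l (a i)⁻¹ y → PP l (a j)⁻¹ y ≤ C0 + δ := by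
    intro i j hij h
    rw [H.comm]
    exact H.hn (ha2 i j hij).2 h
  rcases hbad 0 1 (by decide) with h | h
  · rcases hbad 1 2 (by decide) with h' | h'
    · linarith [hgood 0 1 (by decide) h]
    · linarith [hgood 0 2 (by decide) h]
  · rcases hbad 0 2 (by decide) with h' | h'
    · linarith [hgood 1 0 (by decide) h]
    · linarith [hgood 1 2 (by decide) h]

lemma away (H : HL l δ) (hne : Nonelementary Γ) :
    ∃ C : ℝ, 0 ≤ C ∧ ∀ (n : ℝ) (p q : Γ), ∃ z, n ≤ l z ∧ PP l z p ≤ C ∧ PP l z q ≤ C := by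
  have hd := H.d0
  obtain ⟨C0, hC0, Df, h3⟩ := H.exists_three hne
  refine ⟨C0 + δ, by linarith, fun n p q => ?_⟩
  obtain ⟨a, ha1, ha2⟩ := h3 n
  obtain ⟨i, hi1, hi2⟩ := H.three_away (fun i j hij => (ha2 i j hij).1) p q
  exact ⟨a i, (ha1 i).1, hi1, hi2⟩

/-- Eventual lower bound of the Gromov product of two sequences. -/
def Lo (l : Γ → ℝ) (u v : ℕ → Γ) (r : ℝ) : Prop :=
  ∃ I : ℕ, ∀ i ≥ I, ∀ j ≥ I, r ≤ PP l (u i) (v j)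

lemma Lo.symm (H : HL l δ) {u v : ℕ → Γ} {r : ℝ} (h : Lo l u v r) : Lo l v u r := by
  obtain ⟨I, h⟩ := h
  exact ⟨I, fun i hi j hj => by rw [H.comm]; exact h j hj i hi⟩

lemma Lo.mono {u v : ℕ → Γ} {r r' : ℝ} (h : Lo l u v r) (hr : r' ≤ r) : Lo l u v r' := by
  obtain ⟨I, h⟩ := h
  exact ⟨I, fun i hi j hj => hr.trans (h i hi j hj)⟩

lemma Lo.trans (H : HL l δ) {u v w : ℕ → Γ} {r : ℝ} (h : Lo l u v r) (h' : Lo l v w r) :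
    Lo l u w (r - δ) := by
  obtain ⟨I, h⟩ := h
  obtain ⟨J, h'⟩ := h'
  refine ⟨max I J, fun i hi j hj => ?_⟩
  exact H.hy (h i (le_of_max_le_left hi) (max I J) (le_max_left _ _))
    (h' (max I J) (le_max_right _ _) j (le_of_max_le_right hj))

lemma Lo.smul (H : HL l δ) {u v : ℕ → Γ} {r : ℝ} (h : Lo l u v r) (g : Γ) :
    Lo l (fun n => g * u n) (fun n => g * v n) (r - l g) := by
  obtain ⟨I, h⟩ := h
  refine ⟨I, fun i hi j hj => ?_⟩
  have := H.pmul_ge g (u i) (v j)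
  have := h i hi j hj
  simp only
  linarith

/-- Convergence to infinity. -/
def Cv (l : Γ → ℝ) (u : ℕ → Γ) : Prop := ∀ r, Lo l u u r

lemma Cv.smul (H : HL l δ) {u : ℕ → Γ} (h : Cv l u) (g : Γ) : Cv l (fun n => g * u n) := by
  intro r
  exact (Lo.smul H (h (r + l g)) g).mono (by linarith)

/-- The generic sequence. -/
lemma exists_generic (H : HL l δ) (hne : Nonelementary Γ) :
    ∃ x : ℕ → Γ, Cv l x ∧
    (∃ C : ℝ, 0 ≤ C ∧ ∀ (g g' : Γ) (N : ℝ), ∃ (w : Γ) (I : ℕ), N ≤ l w ∧ ∀ i ≥ I,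
      PP l w (g * x i) ≤ C ∧ PP l w (g' * x i) ≤ C ∧ ∀ j ≥ I, N ≤ PP l (w * x i) (g * x j)) ∧
    (∀ u : ℕ → Γ, Cv l u → ∀ r : ℝ, ∃ g, Lo l u (fun n => g * x n) r) := by
  have hd := H.d0
  obtain ⟨C, D, hC, hD, hcon⟩ := H.connect hne
  obtain ⟨C2, hC2, haway⟩ := H.away hne
  set L := 2 * C + 4 * δ + 1 with hL
  have hcount : Countable Γ := by
    have : (Set.univ : Set Γ) = ⋃ n : ℕ, {x | l x ≤ n} := by
      ext x
      simp only [Set.mem_univ, Set.mem_iUnion, true_iff]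
      obtain ⟨n, hn⟩ := exists_nat_ge (l x)
      exact ⟨n, hn⟩
    rw [← Set.countable_univ_iff, this]
    exact Set.countable_iUnion fun n => (H.fin n).countable
  have hnonempty : Nonempty {y : Γ // L + D ≤ l y} := by
    obtain ⟨z, hz, _⟩ := haway (L + D) 1 1
    exact ⟨⟨z, hz⟩⟩
  obtain ⟨Y, hY⟩ := exists_surjective_nat {y : Γ // L + D ≤ l y}
  choose a ha1 ha2 using hcon
  let x : ℕ → Γ := fun n => Nat.rec 1 (fun n xn => xn * (a xn⁻¹ (Y n) * (Y n : Γ))) n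
  have hx : ∀ n, x (n + 1) = x n * (a (x n)⁻¹ (Y n) * (Y n : Γ)) := fun n => rfl
  have ht : ∀ n, L ≤ l (a (x n)⁻¹ (Y n) * (Y n : Γ)) := by
    intro n
    have h1 := H.lsub (a (x n)⁻¹ (Y n)) (Y n : Γ)
    have h2 := ha1 (x n)⁻¹ (Y n)
    have h3 := (Y n).2
    linarith
  have hxp : ∀ n, PP l (x n)⁻¹ ((x n)⁻¹ * x (n + 1)) ≤ C := by
    intro n
    rw [hx, inv_mul_cancel_left]
    exact ha2 _ _
  have hxl : ∀ n, L ≤ l ((x n)⁻¹ * x (n + 1)) := by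
    intro n
    rw [hx, inv_mul_cancel_left]
    exact ht n
  -- local to global
  have Q : ∀ d n, PP l (x n)⁻¹ ((x n)⁻¹ * x (n + d)) ≤ C + δ := by
    intro d
    induction d with
    | zero => intro n; rw [Nat.add_zero, inv_mul_cancel, H.pone]; linarith
    | succ d ih =>
      intro n
      rcases Nat.eq_zero_or_pos d with h0 | h0
      · subst h0; have := hxp n; simp only [Nat.zero_add]; linarith
      have h1 := ih (n + 1)
      rw [show n + 1 + d = n + (d + 1) by omega] at h1
      set m := n + (d + 1)
      set t := (x n)⁻¹ * x (n + 1) with htdef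
      have h2 : l t - C ≤ PP l (x (n + 1))⁻¹ ((x (n + 1))⁻¹ * x n) := by
        have e : (x (n + 1))⁻¹ * x n = t⁻¹ := by rw [htdef]; group
        have e' : (x (n + 1))⁻¹ = t⁻¹ * (x n)⁻¹ := by rw [htdef]; group
        rw [e, e', H.comm, H.pleft, inv_inv, H.inv, H.comm]
        linarith [hxp n]
      have h3 := H.hn (z := (x (n + 1))⁻¹ * x n) h1 (by linarith [hxl n])
      have h4 : l t - (C + 2 * δ) ≤ PP l t ((x n)⁻¹ * x m) := by
        have e : (x n)⁻¹ * x m = t * ((x (n + 1))⁻¹ * x m) := by rw [htdef]; group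
        have e' : (x (n + 1))⁻¹ * x n = t⁻¹ := by rw [htdef]; group
        rw [e, H.pleft]
        rw [e'] at h3
        linarith
      have h5 := hxp n
      rw [H.comm] at h5
      rw [H.comm]
      exact H.hn h5 (by linarith [hxl n])
  have hgrow : ∀ n : ℕ, (n : ℝ) ≤ l (x n) := by
    intro n
    induction n with
    | zero => simpa using H.nonneg _
    | succ n ih =>
      have h1 := hxp n
      have h2 := hxl n
      unfold PP at h1
      rw [inv_inv, mul_inv_cancel_left, H.inv] at h1
      push_cast
      linarith
  have hpx : ∀ n m : ℕ, n ≤ m → (n : ℝ) - C - δ ≤ PP l (x n) (x m) := by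
    intro n m hnm
    obtain ⟨d, rfl⟩ := Nat.exists_eq_add_of_le hnm
    have h1 := Q d n
    have h2 := H.pleft (x n) ((x n)⁻¹ * x (n + d))
    rw [mul_inv_cancel_left] at h2
    linarith [hgrow n]
  have hcv : Cv l x := by
    intro r
    obtain ⟨I, hI⟩ := exists_nat_gt (r + C + δ)
    refine ⟨I, fun i hi j hj => ?_⟩
    have hi' : (I : ℝ) ≤ i := by exact_mod_cast hi
    have hj' : (I : ℝ) ≤ j := by exact_mod_cast hj
    rcases le_total i j with h | h
    · linarith [hpx i j h]
    · rw [H.comm]; linarith [hpx j i h]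
  refine ⟨x, hcv, ⟨C2 + 2 * δ, by linarith, fun g g' N => ?_⟩, fun u hu r => ?_⟩
  · -- the recurrence property
    obtain ⟨N', hN1, hN2⟩ : ∃ N' : ℝ, |N| + 2 * C + 2 * C2 + 2 * D + 10 * δ + 1 ≤ N' ∧ L + D ≤ N' :=
      ⟨max (|N| + 2 * C + 2 * C2 + 2 * D + 10 * δ + 1) (L + D), le_max_left _ _, le_max_right _ _⟩
    have hNabs := le_abs_self N
    have hNpos := abs_nonneg N
    obtain ⟨I1, hI1⟩ := (hcv.smul H g) N'
    obtain ⟨I2, hI2⟩ := (hcv.smul H g') N'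
    set J := max I1 I2 with hJ
    obtain ⟨z, hz1, hz2, hz3⟩ := haway N' (g * x J) (g' * x J)
    set z' := g * x J with hz'
    have hz'l : N' ≤ l z' := by
      have := hI1 J (le_max_left _ _) J (le_max_left _ _)
      rwa [H.pself] at this
    have hy : L + D ≤ l (z⁻¹ * z') := by
      unfold PP at hz2
      linarith
    obtain ⟨n, hn⟩ := hY ⟨z⁻¹ * z', hy⟩
    have hxn := hx n
    have hp := ha2 (x n)⁻¹ (Y n)
    have hal := ha1 (x n)⁻¹ (Y n)
    rw [hn] at hxn hp hal
    simp only at hxn hp hal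
    set α := a (x n)⁻¹ (z⁻¹ * z') with hα
    set w := z * (α⁻¹ * (x n)⁻¹) with hw
    have hwx : w * x (n + 1) = z' := by rw [hxn, hw]; group
    have s1 : PP l (α⁻¹ * (x n)⁻¹) (z⁻¹ * z') ≤ C + D := by
      have := H.pmul_le α⁻¹ (x n)⁻¹ (α * (z⁻¹ * z'))
      rw [inv_mul_cancel_left, H.inv] at this
      linarith
    have s2 : N' - C2 ≤ PP l z⁻¹ (z⁻¹ * z') := by
      rw [H.pleft, inv_inv, H.inv]; linarith
    rw [H.comm] at s1 s2
    have s3 := H.hn s1 (z := z⁻¹) (by linarith)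
    have s4 : N' - (C + D + δ) ≤ PP l z w := by
      rw [hw, H.pleft]; linarith
    have hwl : N' - (C + D + δ) ≤ l w := s4.trans (H.ple' _ _)
    have s5 : ∀ i ≥ J, PP l w (g * x i) ≤ C2 + 2 * δ := by
      intro i hi
      have t1 := hI1 J (le_max_left _ _) i ((le_max_left _ _).trans hi)
      rw [H.comm] at hz2
      have t2 := H.hn hz2 (z := g * x i) (by simp only at t1; linarith)
      rw [H.comm] at t2
      have t3 := H.hn t2 (z := w) (by linarith)
      linarith
    have s6 : ∀ i ≥ J, PP l w (g' * x i) ≤ C2 + 2 * δ := by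
      intro i hi
      have t1 := hI2 J (le_max_right _ _) i ((le_max_right _ _).trans hi)
      rw [H.comm] at hz3
      have t2 := H.hn hz3 (z := g' * x i) (by simp only at t1; linarith)
      rw [H.comm] at t2
      have t3 := H.hn t2 (z := w) (by linarith)
      linarith
    refine ⟨w, max J (n + 1), by linarith, fun i hi => ⟨s5 i (le_of_max_le_left hi), s6 i (le_of_max_le_left hi), fun j hj => ?_⟩⟩
    have hi1 : n + 1 ≤ i := le_of_max_le_right hi
    obtain ⟨d, hd'⟩ := Nat.exists_eq_add_of_le hi1
    have q1 := Q d (n + 1)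
    rw [← hd'] at q1
    have e : (x (n + 1))⁻¹ = z'⁻¹ * w := by rw [← hwx]; group
    have q2 : N' - (C2 + 2 * δ) ≤ PP l (x (n + 1))⁻¹ z'⁻¹ := by
      rw [e, H.comm, H.pleft, inv_inv, H.inv, H.comm]
      linarith [s5 J le_rfl]
    have q3 := H.hn q1 (z := z'⁻¹) (by linarith)
    have q4 : N' - (C + 2 * δ) ≤ PP l (w * x i) z' := by
      have e2 : w * x i = z' * ((x (n + 1))⁻¹ * x i) := by rw [e]; group
      rw [e2, H.comm, H.pleft]
      linarith
    have q5 := hI1 J (le_max_left _ _) j ((le_max_left _ _).trans (le_of_max_le_left hj))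
    have q6 := H.hy q4 (y := g * x j) (by simp only at q5; linarith)
    linarith
  · -- density of the orbit
    obtain ⟨I, hI⟩ := hu (r + C + 2 * δ)
    obtain ⟨J, hJ⟩ := hcv (C + δ + D + 1)
    have b1 := ha1 (u I)⁻¹ (x J)
    have b2 := ha2 (u I)⁻¹ (x J)
    set α := a (u I)⁻¹ (x J) with hα
    refine ⟨u I * α, max I J, fun i hi j hj => ?_⟩
    have b3 := hJ J le_rfl j (le_of_max_le_right hj)
    have b4 := H.pmul_ge α (x J) (x j)
    rw [H.comm] at b2
    have b5 := H.hn b2 (z := α * x j) (by linarith)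
    have b6 : r + δ ≤ PP l (u I) (u I * (α * x j)) := by
      rw [H.pleft, H.comm]
      have := hI I le_rfl I le_rfl
      rw [H.pself] at this
      linarith
    have b7 := hI i (le_of_max_le_left hi) I le_rfl
    have b8 := H.hy (a := r + δ) (by linarith) b6
    simp only
    rw [mul_assoc]
    linarith

end HL

/-! ### The cocycle on sequences -/

/-- A Hölder cocycle, seen as a function of sequences converging to infinity. -/
structure SeqCoc {G : Type} [Group G] [MetricSpace G] (l : Γ → ℝ) (δ τ : ℝ) (A : Γ → ℝ)
    (F : Γ → (ℕ → Γ) → G) : Prop where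
  H : HL l δ
  t0 : 0 < τ
  t1 : τ < 1
  hL : ∀ a x y : G, dist (a * x) (a * y) = dist x y
  hR : ∀ a x y : G, dist (x * a) (y * a) = dist x y
  hA : ∀ g, 0 < A g
  hol : ∀ g u v r, HL.Cv l u → HL.Cv l v → HL.Lo l u v r → dist (F g u) (F g v) ≤ A g * τ ^ (r : ℝ)
  coc : ∀ g h u, HL.Cv l u → F (g * h) u = F g u * F h (fun n => g⁻¹ * u n)
  fix : ∀ v, ¬ IsOfFinOrder v → HL.Cv l (fun n => v ^ n) → F v (fun n => v ^ n) = 1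

lemma lim_aux {τ X Y Z : ℝ} (t0 : 0 < τ) (t1 : τ < 1)
    (h : ∃ N0 : ℝ, ∀ N : ℝ, N0 ≤ N → X ≤ Y + Z * τ ^ N) : X ≤ Y := by
  obtain ⟨N0, h⟩ := h
  have h1 : Tendsto (fun N : ℝ => τ ^ N) atTop (𝓝 0) :=
    tendsto_rpow_atTop_of_base_lt_one τ (by linarith) t1
  have h2 : Tendsto (fun N : ℝ => Y + Z * τ ^ N) atTop (𝓝 (Y + Z * 0)) :=
    (h1.const_mul Z).const_add Y
  rw [mul_zero, add_zero] at h2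
  exact ge_of_tendsto h2 (eventually_atTop.2 ⟨N0, h⟩)

namespace SeqCoc

open HL

variable {G : Type} [Group G] [MetricSpace G] {l : Γ → ℝ} {δ τ : ℝ} {A : Γ → ℝ}
  {F : Γ → (ℕ → Γ) → G}

lemma F_eq (K : SeqCoc l δ τ A F) (g : Γ) {u v : ℕ → Γ} (hu : Cv l u) (hv : Cv l v)
    (h : ∀ r, Lo l u v r) : F g u = F g v := by
  have : dist (F g u) (F g v) ≤ 0 := lim_aux K.t0 K.t1 ⟨0, fun N _ => by
    rw [zero_add]; exact K.hol g u v N hu hv (h N)⟩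
  exact dist_le_zero.1 this

lemma F_one (K : SeqCoc l δ τ A F) {u : ℕ → Γ} (hu : Cv l u) : F 1 u = 1 := by
  have := K.coc 1 1 u hu
  simp only [mul_one, inv_one, one_mul] at this
  exact left_eq_mul.1 this

lemma dist_mul_le (K : SeqCoc l δ τ A F) (a b a' b' : G) :
    dist (a * b) (a' * b') ≤ dist a a' + dist b b' := by
  have := dist_triangle (a * b) (a' * b) (a' * b')
  rwa [K.hR, K.hL] at this

lemma bound_gen (K : SeqCoc l δ τ A F) : ∃ A1, 0 < A1 ∧ ∀ s, l s ≤ 1 → A s ≤ A1 := by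
  obtain ⟨M, hM⟩ := ((K.H.fin 1).image A).bddAbove
  refine ⟨max M 1, by positivity, fun s hs => le_max_of_le_left (hM ⟨s, hs, rfl⟩)⟩

lemma sum_bound (K : SeqCoc l δ τ A F) {A1 : ℝ} (hA1 : 0 < A1) (hA : ∀ s, l s ≤ 1 → A s ≤ A1)
    {C ρ : ℝ} {a b : ℕ → Γ} (ha : Cv l a) (hb : Cv l b) (hab : Lo l a b ρ) (n : ℕ) :
    ∀ t, l t = n → (∃ I : ℕ, ∀ i ≥ I, PP l t⁻¹ (a i) ≤ C ∧ PP l t⁻¹ (b i) ≤ C) →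
    dist (F t (fun n => t * a n)) (F t (fun n => t * b n)) ≤
      A1 * τ ^ (ρ - 2 * C) * ((1 - τ ^ n) / (1 - τ)) := by
  have H := K.H
  have t0 := K.t0
  have t1 := K.t1
  have h1t : 0 < 1 - τ := by linarith
  induction n with
  | zero =>
    intro t ht _
    have ht1 : t = 1 := by
      obtain ⟨M, x, h1, h2, h3, -⟩ := H.geo t
      have : M = 0 := by
        have : (M : ℝ) = (0 : ℕ) := by rw [← h1, ht]
        exact_mod_cast this
      rw [← h3, this, h2]
    subst ht1
    rw [K.F_one (ha.smul H 1), K.F_one (hb.smul H 1)]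
    simp
  | succ n ih =>
    intro v hv hI
    obtain ⟨M, x, h1, h2, h3, h4⟩ := H.geo v
    have hM : M = n + 1 := by
      have : (M : ℝ) = (n + 1 : ℕ) := by rw [← h1, hv]
      exact_mod_cast this
    subst hM
    set s := x 1 with hs
    set t := s⁻¹ * v with ht
    have hls : l s = 1 := by
      have := h4 0 1 (by omega) (by omega)
      rw [h2] at this
      simpa using this
    have hlt : l t = n := by
      have := h4 1 (n + 1) (by omega) (by omega)
      rw [h3] at this
      rw [ht, this]; push_cast; ring
    obtain ⟨I, hI⟩ := hI
    have hmono : ∀ y, PP l t⁻¹ y ≤ PP l v⁻¹ y := by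
      intro y
      unfold PP
      rw [H.inv, H.inv, inv_inv, inv_inv, hlt, hv]
      have e : v * y = s * (t * y) := by rw [ht]; group
      have := H.mul s (t * y)
      rw [e]
      push_cast
      linarith
    have i1 := ih t hlt ⟨I, fun i hi => ⟨(hmono _).trans (hI i hi).1, (hmono _).trans (hI i hi).2⟩⟩
    have hst : v = s * t := by rw [ht]; group
    have split : ∀ a : ℕ → Γ, Cv l a → F v (fun n => v * a n) =
        F s (fun n => v * a n) * F t (fun n => t * a n) := by
      intro a ha
      conv_lhs => rw [hst]
      rw [K.coc s t _ (ha.smul H (s * t))]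
      congr 2
      · rw [← hst]
      · funext n; group
    rw [split a ha, split b hb]
    refine (K.dist_mul_le _ _ _ _).trans ?_
    have hlo : Lo l (fun n => v * a n) (fun n => v * b n) (ρ - 2 * C + ((n : ℝ) + 1)) := by
      obtain ⟨J, hJ⟩ := hab
      refine ⟨max I J, fun i hi j hj => ?_⟩
      simp only
      rw [H.pmul, hv, H.comm (a i) v⁻¹, H.comm (b j) v⁻¹]
      have := hJ i (le_of_max_le_right hi) j (le_of_max_le_right hj)
      have := (hI i (le_of_max_le_left hi)).1
      have := (hI j (le_of_max_le_left hj)).2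
      push_cast
      linarith
    have i2 := K.hol s _ _ _ (ha.smul H v) (hb.smul H v) hlo
    rw [Real.rpow_add t0] at i2
    have hpos : 0 < τ ^ (ρ - 2 * C) := Real.rpow_pos_of_pos t0 _
    have i3 : τ ^ ((n : ℝ) + 1) ≤ τ ^ n := by
      have e : τ ^ ((n : ℝ) + 1) = τ ^ (n + 1) := by
        rw [← Real.rpow_natCast]; push_cast; rfl
      rw [e, pow_succ]
      have := pow_pos t0 n
      nlinarith
    have i4 : A s * (τ ^ (ρ - 2 * C) * τ ^ ((n : ℝ) + 1)) ≤ A1 * (τ ^ (ρ - 2 * C) * τ ^ n) := by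
      apply mul_le_mul (hA s hls.le) _ (by positivity) hA1.le
      exact mul_le_mul_of_nonneg_left i3 hpos.le
    calc _ ≤ A1 * (τ ^ (ρ - 2 * C) * τ ^ n) +
          A1 * τ ^ (ρ - 2 * C) * ((1 - τ ^ n) / (1 - τ)) := add_le_add (i2.trans i4) i1
      _ = _ := by field_simp; ring

/-- Key lemma: the closing estimate. -/
lemma key (K : SeqCoc l δ τ A F) {C : ℝ} (hC : 0 ≤ C) : ∃ A', 0 < A' ∧ ∀ (v : Γ) (u : ℕ → Γ) (r : ℝ),
    Cv l u → PP l v v⁻¹ ≤ C → 2 * C + 4 * δ + 1 ≤ l v →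
    (∃ I : ℕ, ∀ i ≥ I, PP l v⁻¹ (v⁻¹ * u i) ≤ C) → Lo l u (fun n => v⁻¹ * u n) r →
    dist (F v u) 1 ≤ A' * τ ^ r := by
  have H := K.H
  have t0 := K.t0
  have t1 := K.t1
  have hd := H.d0
  have h1t : 0 < 1 - τ := by linarith
  obtain ⟨A1, hA1, hA⟩ := K.bound_gen
  refine ⟨A1 * τ ^ (-δ - 2 * (C + δ)) / (1 - τ), by positivity, fun v u r hu hv hlv hI hlo => ?_⟩
  have hlv' : 2 * C + 3 * δ + 1 ≤ l v := by linarith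
  have hcv : Cv l (fun n => v ^ n) := by
    intro r
    obtain ⟨I, hI⟩ := exists_nat_gt (r + C + 2 * δ)
    refine ⟨I, fun i hi j hj => ?_⟩
    have hi' : (I : ℝ) ≤ i := by exact_mod_cast hi
    have hj' : (I : ℝ) ≤ j := by exact_mod_cast hj
    rcases le_total i j with h | h
    · linarith [H.pw_e hC hv hlv' h]
    · rw [H.comm]; linarith [H.pw_e hC hv hlv' h]
  have hinf : ¬ IsOfFinOrder v := by
    rw [isOfFinOrder_iff_pow_eq_one]
    rintro ⟨n, hn, h1⟩
    have := H.pw_d hC hv hlv' n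
    rw [h1, H.one] at this
    have : (0 : ℝ) < n := by exact_mod_cast hn
    linarith
  have hfix := K.fix v hinf hcv
  have hfix' : F v (fun n => v * v ^ n) = 1 := by
    rw [← hfix]
    refine K.F_eq v (hcv.smul H v) hcv (fun r => ?_)
    obtain ⟨I, hI⟩ := hcv r
    refine ⟨I, fun i hi j hj => ?_⟩
    have := hI (i + 1) (by omega) j hj
    simpa only [pow_succ'] using this
  obtain ⟨I, hI⟩ := hI
  obtain ⟨J, hJ⟩ := hlo
  have hα : ∀ j : ℕ, ∀ i ≥ max I J, min (r - δ) j ≤ PP l (v⁻¹ * u i) (v ^ j) := by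
    intro j
    induction j with
    | zero =>
      intro i hi
      exact (min_le_right _ _).trans (by rw [Nat.cast_zero]; exact H.pnonneg _ _)
    | succ j ih =>
      intro i hi
      have a1 := ih i hi
      have a2 := H.pmul v (v⁻¹ * u i) (v ^ j)
      rw [mul_inv_cancel_left, ← pow_succ'] at a2
      have a3 := hI i (le_of_max_le_left hi)
      rw [H.comm] at a3
      have a4 := H.pw_a hC hv hlv' j
      rw [H.comm] at a4
      have a5 := hJ i (le_of_max_le_right hi) i (le_of_max_le_right hi)
      simp only at a5
      rw [H.comm] at a5
      have a6 : min r ((j : ℝ) + 1 + δ) ≤ PP l (u i) (v ^ (j + 1)) := by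
        rcases le_total (r - δ) (j : ℝ) with h | h
        · rw [min_eq_left h] at a1
          exact (min_le_left _ _).trans (by linarith)
        · rw [min_eq_right h] at a1
          exact (min_le_right _ _).trans (by linarith)
      have a7 := H.hy ((min_le_left r ((j : ℝ) + 1 + δ)).trans a5) a6
      refine le_trans ?_ a7
      push_cast
      rcases le_total (r - δ) ((j : ℝ) + 1) with h | h
      · rw [min_eq_left h, min_eq_left (by linarith)]
      · rw [min_eq_right h, min_eq_right (by linarith)]; linarith
  have hab : Lo l (fun n => v⁻¹ * u n) (fun n => v ^ n) (r - δ) := by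
    obtain ⟨N, hN⟩ := exists_nat_gt (r - δ)
    refine ⟨max N (max I J), fun i hi j hj => ?_⟩
    have b1 := hα j i (le_of_max_le_right hi)
    have b2 : (N : ℝ) ≤ j := by exact_mod_cast le_of_max_le_left hj
    rwa [min_eq_left (by linarith)] at b1
  obtain ⟨M, -, hM, -⟩ := H.geo v
  have fin := K.sum_bound hA1 hA (C := C + δ) (hu.smul H v⁻¹) hcv hab M v hM
    ⟨I, fun i hi => ⟨by linarith [hI i hi], H.pw_a hC hv hlv' i⟩⟩
  rw [hfix'] at fin
  simp only [mul_inv_cancel_left] at fin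
  refine fin.trans ?_
  have e : r - δ - 2 * (C + δ) = (-δ - 2 * (C + δ)) + r := by ring
  rw [e, Real.rpow_add t0]
  have p1 : 0 < τ ^ (-δ - 2 * (C + δ)) := Real.rpow_pos_of_pos t0 _
  have p2 : 0 < τ ^ r := Real.rpow_pos_of_pos t0 _
  have p3 : (1 - τ ^ M) / (1 - τ) ≤ 1 / (1 - τ) := by
    apply div_le_div_of_nonneg_right _ h1t.le
    linarith [pow_pos t0 M]
  calc _ ≤ A1 * (τ ^ (-δ - 2 * (C + δ)) * τ ^ r) * (1 / (1 - τ)) :=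
        mul_le_mul_of_nonneg_left p3 (by positivity)
    _ = _ := by ring

lemma inv_eq (K : SeqCoc l δ τ A F) (g : Γ) {x : ℕ → Γ} (hx : Cv l x) :
    F g⁻¹ x = (F g (fun n => g * x n))⁻¹ := by
  have := K.coc g g⁻¹ _ (hx.smul K.H g)
  rw [mul_inv_cancel, K.F_one (hx.smul K.H g)] at this
  simp only [inv_mul_cancel_left] at this
  exact eq_inv_of_mul_eq_one_right this.symm

/-- Hölder estimate on the generic orbit. -/
lemma orbit (K : SeqCoc l δ τ A F) {x : ℕ → Γ} (hx : Cv l x)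
    (hgen : ∃ C : ℝ, 0 ≤ C ∧ ∀ (g g' : Γ) (N : ℝ), ∃ (w : Γ) (I : ℕ), N ≤ l w ∧ ∀ i ≥ I,
      PP l w (g * x i) ≤ C ∧ PP l w (g' * x i) ≤ C ∧ ∀ j ≥ I, N ≤ PP l (w * x i) (g * x j)) :
    ∃ Ac, 0 < Ac ∧ ∀ g g' r, Lo l (fun n => g * x n) (fun n => g' * x n) r →
      dist (F g (fun n => g * x n)) (F g' (fun n => g' * x n)) ≤ Ac * τ ^ r := by
  have H := K.H
  have t0 := K.t0
  have t1 := K.t1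
  have hd := H.d0
  obtain ⟨C, hC, hgen⟩ := hgen
  obtain ⟨A', hA', hkey⟩ := K.key (C := C + 2 * δ) (by linarith)
  refine ⟨A' * τ ^ (-δ), by positivity, fun g g' r hr => ?_⟩
  have hlg := H.nonneg g
  have hlg' := H.nonneg g'
  obtain ⟨Ag, hAg, hkeyg⟩ := K.key (C := C + l g + 2 * δ) (by linarith)
  apply lim_aux (Z := (Ag + A g⁻¹) * τ ^ (- l g)) t0 t1
  refine ⟨|r| + 10 * C + 20 * δ + 4 * l g + 4 * l g' + 10, fun N hN => ?_⟩
  have hr1 := le_abs_self r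
  have hr2 := abs_nonneg r
  obtain ⟨w, I, hwl, hw⟩ := hgen g g' N
  have pw : ∀ i ≥ I, PP l w (w * x i) ≤ C + δ := by
    intro i hi
    have h1 := (hw i hi).2.2 i hi
    have h2 := (hw i hi).1
    rw [H.comm] at h2 h1 ⊢
    exact H.hn h2 (by linarith)
  have pwi : ∀ i ≥ I, N - (C + δ) ≤ PP l w⁻¹ (x i) := by
    intro i hi
    have h1 := pw i hi
    rw [H.pleft] at h1
    linarith
  -- the element v
  set v := g' * w⁻¹ with hv
  have hvi : v⁻¹ = w * g'⁻¹ := by rw [hv]; group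
  have hvl : N - l g' ≤ l v := by
    have := H.lsub g' w⁻¹
    rw [H.inv] at this
    linarith
  have hwv : N - l g' ≤ PP l w v⁻¹ := by
    rw [hvi, H.comm]
    have := H.plip' w g'⁻¹ w
    rw [H.inv, H.pself] at this
    linarith
  have v1 : PP l v v⁻¹ ≤ C + 2 * δ := by
    have h1 := H.hn (hw I le_rfl).2.1 (z := v⁻¹) (by linarith)
    rw [H.comm] at h1
    have h2 := H.pmul_ge g' w⁻¹ (x I)
    have h3 := pwi I le_rfl
    have h4 := H.hn h1 (z := v) (by rw [H.comm, hv]; linarith)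
    linarith
  have v2 : ∀ i ≥ I, PP l v⁻¹ (v⁻¹ * (g' * x i)) ≤ C + 2 * δ := by
    intro i hi
    have e : v⁻¹ * (g' * x i) = w * x i := by rw [hvi]; group
    rw [e]
    have := H.hn (pw i hi) (z := v⁻¹) (by linarith)
    linarith
  have v3 : Lo l (fun n => g' * x n) (fun n => v⁻¹ * (g' * x n)) (r - δ) := by
    refine Lo.trans H (hr.symm H) ⟨I, fun i hi j hj => ?_⟩
    have e : v⁻¹ * (g' * x j) = w * x j := by rw [hvi]; group
    simp only
    rw [e, H.comm]
    have := (hw j hj).2.2 i hi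
    linarith
  have d1 := hkey v (fun n => g' * x n) (r - δ) (hx.smul H g') v1 (by linarith) ⟨I, v2⟩ v3
  -- the element k
  set k := w⁻¹ * g with hk
  have hki : k⁻¹ = g⁻¹ * w := by rw [hk]; group
  have hkl : N - l g ≤ l k := by
    have := H.lsub' w⁻¹ g
    rw [H.inv] at this
    linarith
  have k0 : ∀ i ≥ I, PP l k⁻¹ (x i) ≤ C + l g := by
    intro i hi
    have h1 := H.pmul_le g⁻¹ w (g * x i)
    rw [inv_mul_cancel_left, H.inv] at h1
    rw [hki]
    linarith [(hw i hi).1]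
  have k1 : PP l k k⁻¹ ≤ C + l g + 2 * δ := by
    have h1 := k0 I le_rfl
    rw [H.comm] at h1
    have h2 := H.plip' w⁻¹ g (x I)
    have h3 := pwi I le_rfl
    have h4 := H.hn h1 (z := k) (by rw [H.comm, hk]; linarith)
    linarith
  have k2 : ∀ i ≥ I, PP l k⁻¹ (k⁻¹ * x i) ≤ C + l g + 2 * δ := by
    intro i hi
    have h1 := H.pmul_le g⁻¹ w (w * x i)
    rw [H.inv] at h1
    rw [hki, mul_assoc]
    linarith [pw i hi]
  have k3 : Lo l x (fun n => k⁻¹ * x n) (N - l g) := by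
    refine ⟨I, fun i hi j hj => ?_⟩
    have h1 := H.pmul_ge g⁻¹ (w * x j) (g * x i)
    rw [H.inv, inv_mul_cancel_left, ← mul_assoc, ← hki, H.comm (k⁻¹ * x j)] at h1
    have := (hw j hj).2.2 i hi
    simp only
    linarith
  have d2 := hkeyg k x (N - l g) hx k1 (by linarith) ⟨I, k2⟩ k3
  have d3 := K.hol g⁻¹ x _ _ hx (hx.smul H k⁻¹) k3
  have id1 : F v (fun n => g' * x n) = F g' (fun n => g' * x n) * F w⁻¹ x := by
    rw [hv, K.coc g' w⁻¹ _ (hx.smul H g')]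
    simp only [inv_mul_cancel_left]
  have id2 : F w⁻¹ x = F k x * F g⁻¹ (fun n => k⁻¹ * x n) := by
    rw [← K.coc k g⁻¹ x hx, hk, mul_inv_cancel_right]
  rw [id1, id2] at d1
  rw [K.inv_eq g hx] at d3
  set p := F k x
  set q := F g⁻¹ (fun n => k⁻¹ * x n)
  set β := F g (fun n => g * x n)
  set β' := F g' (fun n => g' * x n)
  have e1 : dist β β' = dist (β' * β⁻¹) 1 := by
    rw [← K.hR β⁻¹ β β', mul_inv_cancel, dist_comm]
  have e2 : dist (β' * β⁻¹) (β' * (p * β⁻¹)) = dist p 1 := by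
    rw [K.hL]
    conv_lhs => rw [← one_mul β⁻¹, ← mul_assoc, mul_one, K.hR]
    rw [dist_comm]
  have e3 : dist (β' * (p * β⁻¹)) (β' * (p * q)) = dist β⁻¹ q := by
    rw [K.hL, K.hL]
  have e4 := dist_triangle4 (β' * β⁻¹) (β' * (p * β⁻¹)) (β' * (p * q)) 1
  rw [e1]
  have r1 : τ ^ (r - δ) = τ ^ (-δ) * τ ^ r := by rw [← Real.rpow_add t0]; congr 1; ring
  have r2 : τ ^ (N - l g) = τ ^ (-l g) * τ ^ N := by rw [← Real.rpow_add t0]; congr 1; ring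
  rw [r1] at d1
  rw [r2] at d2 d3
  calc _ ≤ _ := e4
    _ ≤ Ag * (τ ^ (-l g) * τ ^ N) + A g⁻¹ * (τ ^ (-l g) * τ ^ N) + A' * (τ ^ (-δ) * τ ^ r) := by
        rw [e2, e3]; gcongr
    _ = _ := by ring

lemma main [CompleteSpace G] (K : SeqCoc l δ τ A F) (hne : Nonelementary Γ) :
    ∃ b : (ℕ → Γ) → G, (∃ Ac, 0 < Ac ∧ ∀ u v r, Cv l u → Cv l v → Lo l u v r →
      dist (b u) (b v) ≤ Ac * τ ^ (r : ℝ)) ∧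
      ∀ g u, Cv l u → F g u * b (fun n => g⁻¹ * u n) = b u := by
  have H := K.H
  have t0 := K.t0
  have t1 := K.t1
  have hd := H.d0
  obtain ⟨x, hx, hgen, hdense⟩ := H.exists_generic hne
  obtain ⟨Ac, hAc, horb⟩ := K.orbit hx hgen
  set β : Γ → G := fun g => F g (fun n => g * x n) with hβ
  have hlim : ∀ u, ∃ y : G, Cv l u → ∀ g r, Lo l u (fun n => g * x n) r →
      dist (β g) y ≤ Ac * τ ^ (-δ) * τ ^ r := by
    intro u
    by_cases hu : Cv l u
    swap
    · exact ⟨1, fun h => absurd h hu⟩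
    choose f hf using hdense u hu
    have hest : ∀ g r, Lo l u (fun n => g * x n) r → ∀ N, r ≤ N → dist (β g) (β (f N)) ≤ Ac * τ ^ (-δ) * τ ^ r := by
      intro g r hg N hN
      have h1 := horb g (f N) (r - δ) (Lo.trans H (hg.symm H) ((hf N).mono hN))
      refine h1.trans (le_of_eq ?_)
      rw [mul_assoc, ← Real.rpow_add t0]; congr 2; ring
    have hcs : CauchySeq (fun n : ℕ => β (f n)) := by
      apply cauchySeq_of_le_tendsto_0 (fun n : ℕ => Ac * τ ^ (-δ) * τ ^ (n : ℝ) + Ac * τ ^ (-δ) * τ ^ (n : ℝ))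
      · intro n m N hn hm
        have a1 := hest (f N) N (hf N) n (by exact_mod_cast hn)
        have a2 := hest (f N) N (hf N) m (by exact_mod_cast hm)
        have := dist_triangle_left (β (f n)) (β (f m)) (β (f N))
        linarith
      · have : Tendsto (fun n : ℕ => τ ^ (n : ℝ)) atTop (𝓝 0) :=
          (tendsto_rpow_atTop_of_base_lt_one τ (by linarith) t1).comp tendsto_natCast_atTop_atTop
        have := (this.const_mul (Ac * τ ^ (-δ))).add (this.const_mul (Ac * τ ^ (-δ)))
        simpa using this
    obtain ⟨y, hy⟩ := cauchySeq_tendsto_of_complete hcs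
    refine ⟨y, fun _ g r hg => ?_⟩
    have h1 : Tendsto (fun n : ℕ => dist (β g) (β (f n))) atTop (𝓝 (dist (β g) y)) :=
      tendsto_const_nhds.dist hy
    refine le_of_tendsto h1 ?_
    obtain ⟨N, hN⟩ := exists_nat_ge r
    refine eventually_atTop.2 ⟨N, fun n hn => hest g r hg n ?_⟩
    have : (N : ℝ) ≤ n := by exact_mod_cast hn
    linarith
  choose b hb using hlim
  refine ⟨b, ⟨Ac * τ ^ (-2 * δ), by positivity, fun u v r hu hv huv => ?_⟩, fun g u hu => ?_⟩
  · apply lim_aux (Z := 2 * (Ac * τ ^ (-δ))) t0 t1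
    refine ⟨r, fun N hN => ?_⟩
    obtain ⟨f, hf⟩ := hdense u hu N
    obtain ⟨g, hg⟩ := hdense v hv N
    have a1 := hb u hu f N hf
    have a2 := hb v hv g N hg
    have l1 : Lo l u (fun n => g * x n) (r - δ) := Lo.trans H huv (hg.mono hN)
    have l2 : Lo l (fun n => f * x n) (fun n => g * x n) (r - δ - δ) :=
      Lo.trans H ((hf.symm H).mono (by linarith)) l1
    have a3 := horb f g _ l2
    have e : τ ^ (r - δ - δ) = τ ^ (-2 * δ) * τ ^ r := by
      rw [← Real.rpow_add t0]; congr 1; ring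
    rw [e] at a3
    have a4 := dist_triangle4 (b u) (β f) (β g) (b v)
    rw [dist_comm (b u) (β f)] at a4
    simp only [hβ] at *
    linarith
  · have : dist (F g u * b (fun n => g⁻¹ * u n)) (b u) ≤ 0 := by
      apply lim_aux (Z := A g + Ac * τ ^ (-δ) * τ ^ (-l g) + Ac * τ ^ (-δ)) t0 t1
      refine ⟨0, fun N _ => ?_⟩
      obtain ⟨f, hf⟩ := hdense u hu N
      have a1 := hb u hu f N hf
      have l1 := Lo.smul H hf g⁻¹
      rw [H.inv] at l1
      have l2 : Lo l (fun n => g⁻¹ * u n) (fun n => (g⁻¹ * f) * x n) (N - l g) := by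
        simpa only [mul_assoc] using l1
      have a2 := hb _ (hu.smul H g⁻¹) (g⁻¹ * f) _ l2
      have a3 := K.hol g u _ N hu (hx.smul H f) hf
      have e : β f = F g (fun n => f * x n) * β (g⁻¹ * f) := by
        have := K.coc g (g⁻¹ * f) _ (hx.smul H f)
        rw [mul_inv_cancel_left] at this
        simp only [hβ, mul_assoc]
        exact this
      have a4 := dist_triangle (F g u * b (fun n => g⁻¹ * u n)) (β f) (b u)
      have a5 := K.dist_mul_le (F g u) (b (fun n => g⁻¹ * u n)) (F g (fun n => f * x n)) (β (g⁻¹ * f))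
      rw [← e, dist_comm (b _)] at a5
      have r2 : τ ^ (N - l g) = τ ^ (-l g) * τ ^ N := by rw [← Real.rpow_add t0]; congr 1; ring
      rw [r2] at a2
      have : (A g + Ac * τ ^ (-δ) * τ ^ (-l g) + Ac * τ ^ (-δ)) * τ ^ N =
        A g * τ ^ N + Ac * τ ^ (-δ) * (τ ^ (-l g) * τ ^ N) + Ac * τ ^ (-δ) * τ ^ N := by ring
      linarith
    exact dist_le_zero.1 this

end SeqCoc


/-! ### The word length is a hyperbolic length function -/

section word

variable {S : Set Γ}

lemma words_exist (hS : IsGenSet S) (g : Γ) :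
    ∃ w : List Γ, (∀ x ∈ w, x ∈ S) ∧ w.prod = g := by
  have hg : g ∈ Subgroup.closure S := by rw [hS.2.2]; trivial
  induction hg using Subgroup.closure_induction with
  | mem x hx => exact ⟨[x], by simpa using hx, by simp⟩
  | one => exact ⟨[], by simp, by simp⟩
  | mul x y _ _ h1 h2 =>
    obtain ⟨w1, a1, b1⟩ := h1
    obtain ⟨w2, a2, b2⟩ := h2
    refine ⟨w1 ++ w2, ?_, by rw [List.prod_append, b1, b2]⟩
    intro z hz
    rcases List.mem_append.1 hz with h | h
    · exact a1 z h
    · exact a2 z h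
  | inv x _ h1 =>
    obtain ⟨w1, a1, b1⟩ := h1
    refine ⟨(w1.map fun y => y⁻¹).reverse, ?_, by rw [← b1, List.prod_inv_reverse]⟩
    intro z hz
    rw [List.mem_reverse, List.mem_map] at hz
    obtain ⟨y, hy, rfl⟩ := hz
    exact hS.2.1 _ (a1 y hy)

lemma wl_word (hS : IsGenSet S) (g : Γ) :
    ∃ w : List Γ, w.length = wl S g ∧ (∀ x ∈ w, x ∈ S) ∧ w.prod = g := by
  have : {n : ℕ | ∃ w : List Γ, w.length = n ∧ (∀ x ∈ w, x ∈ S) ∧ w.prod = g}.Nonempty := by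
    obtain ⟨w, h1, h2⟩ := words_exist hS g
    exact ⟨w.length, w, rfl, h1, h2⟩
  exact Nat.sInf_mem this

lemma wl_le {w : List Γ} (h : ∀ x ∈ w, x ∈ S) : wl S w.prod ≤ w.length :=
  Nat.sInf_le ⟨w, rfl, h, rfl⟩

lemma wl_one : wl S (1 : Γ) = 0 := by
  have := wl_le (S := S) (w := ([] : List Γ)) (by simp)
  simpa using this

lemma wl_inv_le (hS : IsGenSet S) (g : Γ) : wl S g⁻¹ ≤ wl S g := by
  obtain ⟨w, h1, h2, h3⟩ := wl_word hS g
  have := wl_le (S := S) (w := (w.map fun y => y⁻¹).reverse) (by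
    intro z hz
    rw [List.mem_reverse, List.mem_map] at hz
    obtain ⟨y, hy, rfl⟩ := hz
    exact hS.2.1 _ (h2 y hy))
  rw [← List.prod_inv_reverse, h3] at this
  simpa [h1] using this

lemma wl_inv (hS : IsGenSet S) (g : Γ) : wl S g⁻¹ = wl S g := by
  apply le_antisymm (wl_inv_le hS g)
  simpa using wl_inv_le hS g⁻¹

lemma wl_mul (hS : IsGenSet S) (g h : Γ) : wl S (g * h) ≤ wl S g + wl S h := by
  obtain ⟨w, h1, h2, h3⟩ := wl_word hS g
  obtain ⟨w', h1', h2', h3'⟩ := wl_word hS h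
  have := wl_le (S := S) (w := w ++ w') (by
    intro z hz
    rcases List.mem_append.1 hz with h | h
    · exact h2 z h
    · exact h2' z h)
  rw [List.prod_append, h3, h3', List.length_append, h1, h1'] at this
  exact this

lemma wl_fin (hS : IsGenSet S) (n : ℕ) : {x : Γ | wl S x ≤ n}.Finite := by
  induction n with
  | zero =>
    apply (Set.finite_singleton (1 : Γ)).subset
    intro x hx
    obtain ⟨w, h1, h2, h3⟩ := wl_word hS x
    have h0 : wl S x = 0 := Nat.le_zero.1 hx
    rw [h0, List.length_eq_zero_iff] at h1
    rw [h1] at h3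
    simpa using h3.symm
  | succ n ih =>
    apply ((Set.finite_singleton (1 : Γ)).union (Set.Finite.image2 (fun a b => a * b) hS.1 ih)).subset
    intro x hx
    obtain ⟨w, h1, h2, h3⟩ := wl_word hS x
    cases w with
    | nil => left; simpa using h3.symm
    | cons a w =>
      right
      refine ⟨a, h2 a (by simp), w.prod, ?_, by simpa using h3⟩
      have h5 := wl_le (S := S) (w := w) (fun z hz => h2 z (by simp [hz]))
      have h6 : wl S x ≤ n + 1 := hx
      simp only [List.length_cons] at h1
      show wl S w.prod ≤ n
      omega

lemma wl_geo (hS : IsGenSet S) (v : Γ) : ∃ (M : ℕ) (x : ℕ → Γ), wl S v = M ∧ x 0 = 1 ∧ x M = v ∧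
    ∀ i j, i ≤ j → j ≤ M → wl S ((x i)⁻¹ * x j) = j - i := by
  obtain ⟨w, h1, h2, h3⟩ := wl_word hS v
  have hx : ∀ i j, i ≤ j → j ≤ w.length →
      wl S ((w.take i).prod⁻¹ * (w.take j).prod) ≤ j - i := by
    intro i j hij hj
    have e : (w.take j).prod = (w.take i).prod * ((w.take j).drop i).prod := by
      rw [← List.prod_append]
      congr 1
      conv_lhs => rw [← List.take_append_drop i (w.take j)]
      rw [List.take_take, min_eq_left hij]
    rw [e, inv_mul_cancel_left]
    refine (wl_le (S := S) ?_).trans ?_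
    · intro z hz
      exact h2 z (List.mem_of_mem_take (List.mem_of_mem_drop hz))
    · simp
      omega
  refine ⟨wl S v, fun i => (w.take i).prod, rfl, by simp, by rw [← h1]; simpa using h3, ?_⟩
  intro i j hij hj
  have a1 := hx 0 i (by omega) (by omega)
  have a2 := hx i j hij (by omega)
  have a3 := hx j w.length (by omega) le_rfl
  simp only [List.take_zero, List.prod_nil, inv_one, one_mul] at a1
  rw [List.take_length, h3] at a3
  have b1 := wl_mul hS (w.take i).prod ((w.take i).prod⁻¹ * (w.take j).prod)
  rw [mul_inv_cancel_left] at b1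
  have b2 := wl_mul hS (w.take j).prod ((w.take j).prod⁻¹ * v)
  rw [mul_inv_cancel_left] at b2
  show wl S ((w.take i).prod⁻¹ * (w.take j).prod) = j - i
  omega

/-- Real-valued word length. -/
noncomputable def ll (S : Set Γ) (x : Γ) : ℝ := (wl S x : ℝ)

lemma gp_eq (hS : IsGenSet S) (x y : Γ) : gp S 1 x y = PP (ll S) x y := by
  unfold gp PP wdist ll
  rw [mul_one, mul_one, wl_inv hS, wl_inv hS]

lemma ll_HL (hS : IsGenSet S) {δ : ℝ} (hδ : IsHyperbolic S δ) : HL (ll S) δ where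
  one := by simp [ll, wl_one]
  inv x := by simp [ll, wl_inv hS]
  mul x y := by unfold ll; exact_mod_cast wl_mul hS x y
  d0 := hδ.1
  hyp x y z := by
    have := hδ.2 x y z
    simpa only [gp_eq hS] using this
  fin R := by
    apply (wl_fin hS ⌈R⌉₊).subset
    intro x hx
    have h1 : (wl S x : ℝ) ≤ R := hx
    have h2 := h1.trans (Nat.le_ceil R)
    exact_mod_cast h2
  geo v := by
    obtain ⟨M, x, h1, h2, h3, h4⟩ := wl_geo hS v
    refine ⟨M, x, by unfold ll; exact_mod_cast h1, h2, h3, ?_⟩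
    intro i j hij hj
    unfold ll
    rw [h4 i j hij hj, Nat.cast_sub hij]

end word

/-! ### Translation to the boundary -/

section bdry

open HL

variable {S : Set Γ} {δ : ℝ}

lemma equiv_iff (hS : IsGenSet S) (u v : ℕ → Γ) : EquivSeq S u v ↔ ∀ r, Lo (ll S) u v r := by
  unfold EquivSeq
  rw [tendsto_atTop]
  apply forall_congr'
  intro r
  rw [eventually_atTop]
  constructor
  · rintro ⟨⟨I, J⟩, h⟩
    refine ⟨max I J, fun i hi j hj => ?_⟩
    rw [← gp_eq hS]
    exact h (i, j) ⟨(le_max_left I J).trans hi, (le_max_right I J).trans hj⟩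
  · rintro ⟨I, h⟩
    refine ⟨(I, I), fun p hp => ?_⟩
    show r ≤ gp S 1 (u p.1) (v p.2)
    rw [gp_eq hS]
    exact h _ hp.1 _ hp.2

lemma conv_iff (hS : IsGenSet S) (u : ℕ → Γ) : ConvInf S u ↔ Cv (ll S) u := equiv_iff hS u u

variable (B : Boundary Γ S)

lemma bgp_ge (hS : IsGenSet S) {u v : ℕ → Γ} {r : ℝ} (hu : Cv (ll S) u) (hv : Cv (ll S) v)
    (h : Lo (ll S) u v r) : ENNReal.ofReal r ≤ bgp B (B.cls u) (B.cls v) := by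
  unfold bgp
  refine le_iSup₂_of_le ⟨u, (conv_iff hS u).2 hu, rfl⟩ ⟨v, (conv_iff hS v).2 hv, rfl⟩ ?_
  refine le_liminf_of_le (by isBoundedDefault) ?_
  obtain ⟨I, hI⟩ := h
  filter_upwards [eventually_ge_atTop (I, I)] with p hp
  apply ENNReal.ofReal_le_ofReal
  rw [gp_eq hS]
  exact hI _ hp.1 _ hp.2

lemma bgp_lt (hS : IsGenSet S) (hδ : IsHyperbolic S δ) {u v : ℕ → Γ} {r : ℝ}
    (hu : Cv (ll S) u) (hv : Cv (ll S) v)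
    (h : ENNReal.ofReal r < bgp B (B.cls u) (B.cls v)) : Lo (ll S) u v (r - 2 * δ) := by
  have H := ll_HL hS hδ
  unfold bgp at h
  simp only [lt_iSup_iff] at h
  obtain ⟨⟨u', cu, hu'⟩, ⟨v', cv, hv'⟩, h⟩ := h
  have h1 := eventually_lt_of_lt_liminf h (by isBoundedDefault)
  obtain ⟨⟨I, J⟩, hI⟩ := eventually_atTop.1 h1
  have h2 : Lo (ll S) u' v' r := by
    refine ⟨max I J, fun i hi j hj => ?_⟩
    have h3 := hI (i, j) ⟨(le_max_left I J).trans hi, (le_max_right I J).trans hj⟩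
    rw [← gp_eq hS]
    exact (ENNReal.ofReal_lt_ofReal_iff'.1 h3).1.le
  have e1 := (equiv_iff hS u u').1
    ((B.cls_eq u u' ((conv_iff hS u).2 hu) cu).1 hu'.symm)
  have e2 := (equiv_iff hS v' v).1
    ((B.cls_eq v' v cv ((conv_iff hS v).2 hv)).1 hv')
  have h4 := Lo.trans H (e1 r) h2
  have h5 := Lo.trans H h4 (e2 (r - δ))
  exact h5.mono (by linarith)

lemma bgp_ne_top (hS : IsGenSet S) (hδ : IsHyperbolic S δ) {ξ η : B.pt} (h : ξ ≠ η) :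
    bgp B ξ η ≠ ⊤ := by
  intro ht
  obtain ⟨u, cu, rfl⟩ := B.cls_surj ξ
  obtain ⟨v, cv, rfl⟩ := B.cls_surj η
  apply h
  rw [B.cls_eq u v cu cv, equiv_iff hS]
  intro r
  have := bgp_lt B hS hδ (r := r + 2 * δ) ((conv_iff hS u).1 cu) ((conv_iff hS v).1 cv)
    (by rw [ht]; exact ENNReal.ofReal_lt_top)
  exact this.mono (by linarith)

lemma bgpR_lo (hS : IsGenSet S) (hδ : IsHyperbolic S δ) {u v : ℕ → Γ}
    (hu : Cv (ll S) u) (hv : Cv (ll S) v) (h : B.cls u ≠ B.cls v) :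
    Lo (ll S) u v (bgpR B (B.cls u) (B.cls v) - 1 - 2 * δ) := by
  have H := ll_HL hS hδ
  by_cases h1 : bgpR B (B.cls u) (B.cls v) ≤ 1
  · refine ⟨0, fun i _ j _ => ?_⟩
    have := H.pnonneg (u i) (v j)
    have := H.d0
    linarith
  · push Not at h1
    apply bgp_lt B hS hδ hu hv
    rw [← ENNReal.ofReal_toReal (bgp_ne_top B hS hδ h)]
    show ENNReal.ofReal (bgpR B (B.cls u) (B.cls v) - 1) < ENNReal.ofReal (bgpR B (B.cls u) (B.cls v))
    exact (ENNReal.ofReal_lt_ofReal_iff (by linarith)).2 (by linarith)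

lemma bgpR_ge (hS : IsGenSet S) (hδ : IsHyperbolic S δ) {u v : ℕ → Γ} {r : ℝ}
    (hu : Cv (ll S) u) (hv : Cv (ll S) v) (h : B.cls u ≠ B.cls v)
    (hr : Lo (ll S) u v r) : r ≤ bgpR B (B.cls u) (B.cls v) := by
  have h1 := bgp_ge B hS hu hv hr
  exact (ENNReal.ofReal_le_iff_le_toReal (bgp_ne_top B hS hδ h)).1 h1

end bdry

theorem livschitz
    (Γ : Type) [Group Γ] (S : Set Γ) (δ : ℝ)
    (hS : IsGenSet S) (hδ : IsHyperbolic S δ) (hne : Nonelementary Γ)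
    (B : Boundary Γ S)
    (G : Type) [Group G] [MetricSpace G] [CompleteSpace G]
    (hinvL : ∀ a x y : G, dist (a * x) (a * y) = dist x y)
    (hinvR : ∀ a x y : G, dist (x * a) (y * a) = dist x y)
    (τ : ℝ) (hτ0 : 0 < τ) (hτ1 : τ < 1)
    (c : Γ → B.pt → G)
    (A : Γ → ℝ) (hA : ∀ g : Γ, 0 < A g)
    (hHolder : ∀ (g : Γ) (ξ η : B.pt), dist (c g ξ) (c g η) ≤ A g * τ ^ (bgpR B ξ η))
    (hcocycle : ∀ (g h : Γ) (ω : B.pt), c (g * h) ω = c g ω * c h (B.smul g⁻¹ ω))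
    (hfix : ∀ g : Γ, ¬ IsOfFinOrder g → c g (plusPt B g) = 1 ∧ c g (minusPt B g) = 1) :
    ∃ b : B.pt → G, (@Continuous B.pt G (btop B) _ b) ∧
      (∀ (g : Γ) (ξ : B.pt), c g ξ = b ξ * (b (B.smul g⁻¹ ξ))⁻¹) ∧
      ∃ Ac : ℝ, 0 < Ac ∧ ∀ ξ η : B.pt, dist (b ξ) (b η) ≤ Ac * τ ^ (bgpR B ξ η) := by
  have H := ll_HL hS hδ
  have K : SeqCoc (ll S) δ τ A (fun g u => c g (B.cls u)) :=
    { H := H, t0 := hτ0, t1 := hτ1, hL := hinvL, hR := hinvR, hA := hA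
      hol := by
        intro g u v r hu hv hr
        by_cases h : B.cls u = B.cls v
        · have h0 : dist (c g (B.cls u)) (c g (B.cls v)) = 0 := by rw [h, dist_self]
          have h1 : 0 < A g * τ ^ r := mul_pos (hA g) (Real.rpow_pos_of_pos hτ0 r)
          show dist (c g (B.cls u)) (c g (B.cls v)) ≤ A g * τ ^ r
          rw [h0]; exact h1.le
        · refine (hHolder g _ _).trans ?_
          apply mul_le_mul_of_nonneg_left _ (hA g).le
          exact Real.rpow_le_rpow_of_exponent_ge hτ0 hτ1.le (bgpR_ge B hS hδ hu hv h hr)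
      coc := by
        intro g h u hu
        show c (g * h) (B.cls u) = c g (B.cls u) * c h (B.cls fun n => g⁻¹ * u n)
        rw [hcocycle, B.smul_cls _ _ ((conv_iff hS u).2 hu)]
      fix := by
        intro v hv _
        exact (hfix v hv).1 }
  obtain ⟨b, ⟨Ac, hAc, hb1⟩, hb2⟩ := K.main hne
  choose rep hrep hcls using B.cls_surj
  have hrep' : ∀ ξ, HL.Cv (ll S) (rep ξ) := fun ξ => (conv_iff hS _).1 (hrep ξ)
  have hb3 : ∀ u, HL.Cv (ll S) u → b (rep (B.cls u)) = b u := by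
    intro u hu
    have e1 := (equiv_iff hS _ _).1
      ((B.cls_eq _ u (hrep (B.cls u)) ((conv_iff hS u).2 hu)).1 (hcls (B.cls u)))
    have : dist (b (rep (B.cls u))) (b u) ≤ 0 := by
      apply lim_aux hτ0 hτ1 (Z := Ac)
      refine ⟨0, fun N _ => ?_⟩
      rw [zero_add]
      exact hb1 _ _ N (hrep' _) hu (e1 N)
    exact dist_le_zero.1 this
  have hA' : 0 < Ac * τ ^ (-1 - 2 * δ) := mul_pos hAc (Real.rpow_pos_of_pos hτ0 _)
  have hhol : ∀ ξ η : B.pt,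
      dist (b (rep ξ)) (b (rep η)) ≤ Ac * τ ^ (-1 - 2 * δ) * τ ^ (bgpR B ξ η) := by
    intro ξ η
    by_cases h : ξ = η
    · rw [h, dist_self]
      exact (mul_pos hA' (Real.rpow_pos_of_pos hτ0 _)).le
    · have h1 := bgpR_lo B hS hδ (hrep' ξ) (hrep' η) (by rw [hcls, hcls]; exact h)
      rw [hcls, hcls] at h1
      have h2 := hb1 _ _ _ (hrep' ξ) (hrep' η) h1
      rw [mul_assoc, ← Real.rpow_add hτ0]
      convert h2 using 3
      ring
  refine ⟨fun ξ => b (rep ξ), ?_, ?_, Ac * τ ^ (-1 - 2 * δ), hA', hhol⟩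
  · letI := btop B
    rw [continuous_def]
    intro O hO p hp
    obtain ⟨ε, hε, hball⟩ := Metric.isOpen_iff.1 hO _ hp
    have ht : Tendsto (fun N : ℝ => Ac * τ ^ (-1 - 2 * δ) * τ ^ N) atTop
        (𝓝 (Ac * τ ^ (-1 - 2 * δ) * 0)) :=
      (tendsto_rpow_atTop_of_base_lt_one τ (by linarith) hτ1).const_mul _
    rw [mul_zero] at ht
    obtain ⟨r, hr⟩ := (ht.eventually (gt_mem_nhds hε)).exists
    refine ⟨ENNReal.ofReal r, ENNReal.ofReal_ne_top, fun q hq => ?_⟩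
    have hq1 : ENNReal.ofReal r < bgp B q p := hq
    by_cases h : q = p
    · rw [h]; exact hp
    · have h2 : r ≤ bgpR B q p :=
        (ENNReal.ofReal_le_iff_le_toReal (bgp_ne_top B hS hδ h)).1 hq1.le
      apply hball
      rw [Metric.mem_ball]
      refine lt_of_le_of_lt (hhol q p) (lt_of_le_of_lt ?_ hr)
      apply mul_le_mul_of_nonneg_left _ hA'.le
      exact Real.rpow_le_rpow_of_exponent_ge hτ0 hτ1.le h2
  · intro g ξ
    have h1 := hb2 g (rep ξ) (hrep' ξ)
    have h2 : B.smul g⁻¹ ξ = B.cls fun n => g⁻¹ * rep ξ n := by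
      rw [← B.smul_cls _ _ (hrep ξ), hcls]
    have h3 := hb3 _ (HL.Cv.smul H (hrep' ξ) g⁻¹)
    show c g ξ = b (rep ξ) * (b (rep (B.smul g⁻¹ ξ)))⁻¹
    rw [h2, h3, ← h1, mul_inv_cancel_right, hcls]

end HarmonicBoundary
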